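/- arXiv:1107.4754 — 2 statements merged into one kernel-verified Lean document; each statement's English description precedes it below -/
import Mathlib

section
/- Assume the weight sequence b satisfies conditions (M1) and (M2). Then there exist constants K > 0 and α₀ > 0 such that for every complex τ = α + iθ with 0 < α ≤ α₀, |θ| ≤ π and |arg τ| ≤ π/4, one has |log f_b(e^{−τ}) − (A Γ(ρ) ζ(ρ+1) τ^{−ρ} − D(0)·log τ + D′(0))| ≤ K α^{C₀}, where D(0) and D′(0) are the value and derivative at s = 0 of the analytic continuation of D. In particular f_b(e^{−τ}) = exp(A Γ(ρ) ζ(ρ+1) τ^{−ρ} − D(0) log τ + D′(0) + O(α^{C₀})) uniformly in this region as α → 0⁺. -/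
open Filter Topology Asymptotics MeasureTheory Real

noncomputable section

/-- `F_b(x) = -∑_{k≥1} b_k log(1 - x^k)` (so that `f_b = exp F_b`). -/
def Fb (b : ℕ → ℝ) (x : ℝ) : ℝ := -∑' k : ℕ, b (k + 1) * Real.log (1 - x ^ (k + 1))

/-- Complex version of `log f_b` (principal branch). -/
def FbC (b : ℕ → ℝ) (x : ℂ) : ℂ := -∑' k : ℕ, (b (k + 1) : ℂ) * Complex.log (1 - x ^ (k + 1))

/-- `f_b(x) = ∏_{k≥1} (1 - x^k)^{-b_k}`. -/
def fb (b : ℕ → ℝ) (x : ℝ) : ℝ := Real.exp (Fb b x)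

/-- Complex version of `f_b`. -/
def fbC (b : ℕ → ℝ) (x : ℂ) : ℂ := Complex.exp (FbC b x)

/-- `F_{m,b}(x) = -∑_{k=1}^m b_k log(1 - x^k)`. -/
def Fmb (b : ℕ → ℝ) (m : ℕ) (x : ℝ) : ℝ := -∑ k ∈ Finset.Icc 1 m, b k * Real.log (1 - x ^ k)

/-- `f_{m,b}(x) = ∏_{k=1}^m (1 - x^k)^{-b_k}`. -/
def fmb (b : ℕ → ℝ) (m : ℕ) (x : ℝ) : ℝ := Real.exp (Fmb b m x)

/-- `𝒜_b(r) = r F_b'(r)`. -/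
def Abf (b : ℕ → ℝ) (r : ℝ) : ℝ := r * deriv (Fb b) r

/-- `ℬ_b(r) = r² F_b''(r) + r F_b'(r)`. -/
def Bbf (b : ℕ → ℝ) (r : ℝ) : ℝ :=
  r ^ 2 * iteratedDeriv 2 (Fb b) r + r * deriv (Fb b) r

/-- Meinardus condition (M1): the Dirichlet series `D(s) = ∑_{k≥1} b_k k^{-s}` converges for
`Re s > ρ` and `Dc` is its analytic continuation to `{Re s ≥ -C₀}`, analytic there except for a
simple pole at `s = ρ` with residue `A > 0`. -/
def M1 (b : ℕ → ℝ) (ρ C₀ A : ℝ) (Dc : ℂ → ℂ) : Prop :=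
  0 < ρ ∧ 0 < C₀ ∧ C₀ < 1 ∧ 0 < A ∧
  (∀ s : ℂ, ρ < s.re →
    HasSum (fun k : ℕ => (b (k + 1) : ℂ) * ((k + 1 : ℕ) : ℂ) ^ (-s)) (Dc s)) ∧
  (∀ s : ℂ, -C₀ ≤ s.re → s ≠ (ρ : ℂ) → DifferentiableAt ℂ Dc s) ∧
  (∃ φ : ℂ → ℂ, (∀ s : ℂ, -C₀ ≤ s.re → DifferentiableAt ℂ φ s) ∧
    ∀ s : ℂ, -C₀ ≤ s.re → s ≠ (ρ : ℂ) → Dc s = (A : ℂ) / (s - (ρ : ℂ)) + φ s)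

/-- Meinardus condition (M2): the continuation `Dc` is of finite order `C₁` in `{Re s ≥ -C₀}`,
i.e. `Dc s = O(|Im s|^{C₁})` as `|Im s| → ∞`, uniformly in `Re s ≥ -C₀`. -/
def M2 (C₀ C₁ : ℝ) (Dc : ℂ → ℂ) : Prop :=
  0 < C₁ ∧ ∃ K y₀ : ℝ, ∀ s : ℂ, -C₀ ≤ s.re → y₀ ≤ |s.im| → ‖Dc s‖ ≤ K * |s.im| ^ C₁

/-- Meinardus condition (M3): `∑_{k≥1} b_k e^{-kα} sin²(πku) ≥ C₂ α^{-ε}` for all small `α > 0`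
and all `u` with `α/(2π) < |u| ≤ 1/2`. -/
def M3 (b : ℕ → ℝ) : Prop :=
  ∃ ε C₂ : ℝ, 0 < ε ∧ 0 < C₂ ∧ ∃ α₀ : ℝ, 0 < α₀ ∧ ∀ α : ℝ, 0 < α → α ≤ α₀ →
    ∀ u : ℝ, α / (2 * π) < |u| → |u| ≤ 1 / 2 →
      C₂ * α ^ (-ε) ≤
        ∑' k : ℕ, b (k + 1) * Real.exp (-((k : ℝ) + 1) * α) * Real.sin (π * ((k : ℝ) + 1) * u) ^ 2

/-- `h = A Γ(ρ+1) ζ(ρ+1)`. -/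
def hMein (ρ A : ℝ) : ℝ := A * Real.Gamma (ρ + 1) * (riemannZeta ((ρ : ℂ) + 1)).re

/-- The normalizing constant `a(n) = (A Γ(ρ+1) ζ(ρ+1) / n)^{1/(ρ+1)}`. -/
def aM (ρ A : ℝ) (n : ℕ) : ℝ := (hMein ρ A / n) ^ ((1 : ℝ) / (ρ + 1))


lemma aux_int (σ r : ℝ) (hσ : 0 < σ) (hr : 0 < r) :
    IntegrableOn (fun t : ℝ => t ^ (σ - 1) * Real.exp (-(r * t))) (Set.Ioi 0) := by
  have := integrableOn_rpow_mul_exp_neg_mul_rpow (s := σ - 1) (p := 1) (b := r) (by linarith) zero_lt_one hr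
  simpa [neg_mul] using this

lemma aux_norm (s τ : ℂ) (t : ℝ) (ht : 0 < t) :
    ‖(t : ℂ) ^ (s - 1) * Complex.exp (-(τ * t))‖ = t ^ (s.re - 1) * Real.exp (-(τ.re * t)) := by
  rw [norm_mul, Complex.norm_cpow_eq_rpow_re_of_pos ht, Complex.norm_exp]
  simp

lemma aux_contOn (s τ : ℂ) :
    ContinuousOn (fun t : ℝ => (t : ℂ) ^ (s - 1) * Complex.exp (-(τ * t))) (Set.Ioi 0) := by
  apply ContinuousOn.mul
  · intro t ht
    apply ContinuousAt.continuousWithinAt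
    exact (Complex.continuousAt_ofReal_cpow_const t _ (Or.inr (ne_of_gt ht)))
  · fun_prop

lemma aux_intC (s τ : ℂ) (hs : 0 < s.re) (hτ : 0 < τ.re) :
    IntegrableOn (fun t : ℝ => (t : ℂ) ^ (s - 1) * Complex.exp (-(τ * t))) (Set.Ioi 0) := by
  refine (aux_int s.re τ.re hs hτ).mono' ((aux_contOn s τ).aestronglyMeasurable measurableSet_Ioi) ?_
  filter_upwards [ae_restrict_mem measurableSet_Ioi] with t ht
  rw [aux_norm s τ t ht]

lemma aux_diff (s τ : ℂ) (hs : 0 < s.re) (hτ : 0 < τ.re) :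
    DifferentiableAt ℂ (fun τ : ℂ => ∫ t in Set.Ioi (0:ℝ), (t : ℂ) ^ (s - 1) * Complex.exp (-(τ * t))) τ := by
  have hU : {z : ℂ | τ.re / 2 < z.re} ∈ 𝓝 τ :=
    (isOpen_lt continuous_const Complex.continuous_re).mem_nhds (by simp; linarith)
  have key := hasDerivAt_integral_of_dominated_loc_of_deriv_le (μ := volume.restrict (Set.Ioi (0:ℝ)))
    (F := fun (τ : ℂ) (t : ℝ) => (t : ℂ) ^ (s - 1) * Complex.exp (-(τ * t)))
    (F' := fun (τ : ℂ) (t : ℝ) => (t : ℂ) ^ (s - 1) * (Complex.exp (-(τ * t)) * (-t)))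
    (x₀ := τ) (s := {z : ℂ | τ.re / 2 < z.re})
    (bound := fun t => t ^ (s.re + 1 - 1) * Real.exp (-(τ.re / 2 * t))) hU
    (Eventually.of_forall fun z => (aux_contOn s z).aestronglyMeasurable measurableSet_Ioi)
    (aux_intC s τ hs hτ) ?_ ?_ (aux_int (s.re + 1) (τ.re / 2) (by linarith) (by linarith)) ?_
  · exact key.2.differentiableAt
  · have : ContinuousOn (fun t : ℝ => ((t : ℂ) ^ (s - 1) * Complex.exp (-(τ * t))) * (-t : ℂ)) (Set.Ioi 0) :=
      (aux_contOn s τ).mul (by fun_prop)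
    simpa only [mul_assoc] using this.aestronglyMeasurable measurableSet_Ioi
  · filter_upwards [ae_restrict_mem measurableSet_Ioi] with t ht z hz
    have ht' : 0 < t := ht
    rw [← mul_assoc, norm_mul, aux_norm s z t ht, norm_neg, Complex.norm_real, Real.norm_of_nonneg ht'.le]
    have h1 : t ^ (s.re + 1 - 1) = t ^ (s.re - 1) * t := by
      rw [← Real.rpow_add_one ht'.ne']; congr 1; ring
    rw [h1, mul_assoc, mul_assoc, mul_comm t]
    have hz' : τ.re / 2 < z.re := hz
    gcongr
  · refine Eventually.of_forall fun t z _ => ?_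
    have : HasDerivAt (fun z : ℂ => -(z * t)) (-(t:ℂ)) z := by
      simpa using ((hasDerivAt_id z).mul_const (t:ℂ)).fun_neg
    exact this.cexp.const_mul _

lemma gamma_mellin (s τ : ℂ) (hs : 0 < s.re) (hτ : 0 < τ.re) :
    ∫ t in Set.Ioi (0:ℝ), (t : ℂ) ^ (s - 1) * Complex.exp (-(τ * t)) = Complex.Gamma s * τ ^ (-s) := by
  have hopen : IsOpen {z : ℂ | 0 < z.re} := isOpen_lt continuous_const Complex.continuous_re
  have hf : AnalyticOnNhd ℂ (fun τ : ℂ => ∫ t in Set.Ioi (0:ℝ), (t : ℂ) ^ (s - 1) * Complex.exp (-(τ * t)))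
      {z : ℂ | 0 < z.re} :=
    DifferentiableOn.analyticOnNhd (fun z hz => (aux_diff s z hs hz).differentiableWithinAt) hopen
  have hg : AnalyticOnNhd ℂ (fun τ : ℂ => Complex.Gamma s * τ ^ (-s)) {z : ℂ | 0 < z.re} := by
    refine DifferentiableOn.analyticOnNhd (fun z hz => DifferentiableAt.differentiableWithinAt ?_) hopen
    refine DifferentiableAt.const_mul ?_ _
    exact DifferentiableAt.cpow_const differentiableAt_id (Or.inl hz)
  refine hf.eqOn_of_preconnected_of_frequently_eq hg (convex_halfSpace_re_gt 0).isPreconnected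
    (z₀ := 1) (by simp) ?_ hτ
  have ht : Tendsto (fun x : ℝ => (x : ℂ)) (𝓝[>] 1) (𝓝[≠] 1) := by
    refine tendsto_nhdsWithin_iff.2 ⟨?_, ?_⟩
    · exact (Complex.continuous_ofReal.tendsto' 1 1 (by simp)).mono_left nhdsWithin_le_nhds
    · filter_upwards [self_mem_nhdsWithin] with x hx
      have : (1:ℝ) < x := hx
      simp; exact_mod_cast this.ne'
  refine ht.frequently (Eventually.frequently ?_)
  filter_upwards [self_mem_nhdsWithin] with x hx
  have hx0 : (0:ℝ) < x := lt_trans zero_lt_one hx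
  have := Complex.integral_cpow_mul_exp_neg_mul_Ioi hs hx0
  rw [this, one_div, Complex.inv_cpow _ _ (by rw [Complex.arg_ofReal_of_nonneg hx0.le]; exact Real.pi_pos.ne), Complex.cpow_neg, mul_comm]

lemma norm_cpow_neg (τ s : ℂ) (hτ : τ ≠ 0) :
    ‖τ ^ (-s)‖ = ‖τ‖ ^ (-s.re) * Real.exp (τ.arg * s.im) := by
  rw [Complex.norm_cpow_of_ne_zero hτ, Complex.neg_re, Complex.neg_im, mul_neg, Real.exp_neg, div_inv_eq_mul]

lemma gamma_bound (s : ℂ) (hs : 0 < s.re) :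
    ‖Complex.Gamma s‖ ≤ Real.Gamma s.re * 2 ^ s.re * Real.exp (-(π / 3 * |s.im|)) := by
  obtain ⟨θ, hθ, hθ2, hθ3⟩ : ∃ θ : ℝ, |θ| = π / 3 ∧ θ * s.im = π / 3 * |s.im| ∧ Real.cos θ = 1 / 2 := by
    rcases le_total 0 s.im with h | h
    · exact ⟨π / 3, abs_of_pos (by positivity), by rw [abs_of_nonneg h], Real.cos_pi_div_three⟩
    · exact ⟨-(π / 3), by rw [abs_neg]; exact abs_of_pos (by positivity), by rw [abs_of_nonpos h]; ring, by
        rw [Real.cos_neg, Real.cos_pi_div_three]⟩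
  have hpi := Real.pi_pos
  set τ : ℂ := Complex.exp (θ * Complex.I) with hτ
  have hre : τ.re = 1 / 2 := by rw [hτ, Complex.exp_ofReal_mul_I_re, hθ3]
  have hn : ‖τ‖ = 1 := Complex.norm_exp_ofReal_mul_I θ
  have hτ0 : τ ≠ 0 := Complex.exp_ne_zero _
  have harg : τ.arg = θ := by
    rw [hτ, Complex.arg_exp_mul_I, toIocMod_eq_self]
    have := abs_le.1 hθ.le
    constructor <;> linarith
  have h1 := gamma_mellin s τ hs (by rw [hre]; norm_num)
  have h2 : ‖Complex.Gamma s * τ ^ (-s)‖ ≤ ∫ t in Set.Ioi (0:ℝ), t ^ (s.re - 1) * Real.exp (-(1/2 * t)) := by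
    rw [← h1]
    refine norm_integral_le_of_norm_le (aux_int s.re (1/2) hs (by norm_num)) ?_
    filter_upwards [ae_restrict_mem measurableSet_Ioi] with t ht
    rw [aux_norm s τ t ht, hre]
  rw [Real.integral_rpow_mul_exp_neg_mul_Ioi hs (by norm_num), norm_mul, norm_cpow_neg τ s hτ0, hn,
    harg, hθ2, Real.one_rpow, one_mul] at h2
  rw [Real.exp_neg, ← div_eq_mul_inv, le_div_iff₀ (Real.exp_pos _)]
  refine h2.trans (le_of_eq ?_)
  norm_num [mul_comm]


lemma integrable_exp_neg_abs (κ : ℝ) (hκ : 0 < κ) : Integrable (fun y : ℝ => Real.exp (-(κ * |y|))) := by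
  rw [← integrableOn_univ, ← Set.Iic_union_Ioi (a := (0:ℝ))]
  refine IntegrableOn.union ?_ ?_
  · refine (integrableOn_exp_mul_Iic hκ 0).congr_fun (fun y hy => ?_) measurableSet_Iic
    have : y ≤ 0 := hy
    simp [abs_of_nonpos this]
  · refine (exp_neg_integrableOn_Ioi 0 hκ).congr_fun (fun y hy => ?_) measurableSet_Ioi
    have : 0 < y := hy
    simp [abs_of_pos this]

lemma gamma_vert_cont (c : ℝ) (hc : 0 < c) (τ : ℂ) (hτ : τ ≠ 0) :
    Continuous (fun y : ℝ => Complex.Gamma (c + y * Complex.I) * τ ^ (-(c + y * Complex.I))) := by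
  refine Continuous.mul ?_ ?_
  · refine continuous_iff_continuousAt.2 fun y => ?_
    refine ContinuousAt.comp (f := fun y : ℝ => (c + y * Complex.I : ℂ)) (g := Complex.Gamma) ?_ (by fun_prop)
    refine (Complex.differentiableAt_Gamma _ fun m h => ?_).continuousAt
    have := congrArg Complex.re h
    simp at this
    have h2 : (0:ℝ) ≤ m := Nat.cast_nonneg m
    linarith
  · exact Continuous.const_cpow (by fun_prop) (Or.inl hτ)

lemma gamma_vert_int (c : ℝ) (hc : 0 < c) (τ : ℂ) (hτ : τ ≠ 0) (harg : |τ.arg| ≤ π / 4) :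
    Integrable (fun y : ℝ => Complex.Gamma (c + y * Complex.I) * τ ^ (-(c + y * Complex.I))) := by
  have hpi := Real.pi_pos
  refine ((integrable_exp_neg_abs (π / 12) (by positivity)).const_mul
    (Real.Gamma c * 2 ^ c * ‖τ‖ ^ (-c))).mono' (gamma_vert_cont c hc τ hτ).aestronglyMeasurable ?_
  refine Eventually.of_forall fun y => ?_
  have h1 := gamma_bound (c + y * Complex.I) (by simpa using hc)
  have h2 := norm_cpow_neg τ (c + y * Complex.I) hτ
  simp only [Complex.add_re, Complex.ofReal_re, Complex.mul_re, Complex.I_re, mul_zero, Complex.ofReal_im,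
    Complex.I_im, mul_one, sub_self, add_zero, Complex.add_im, Complex.mul_im, zero_add] at h1 h2
  have h3 : τ.arg * y ≤ π / 4 * |y| := by
    calc τ.arg * y ≤ |τ.arg * y| := le_abs_self _
      _ = |τ.arg| * |y| := abs_mul _ _
      _ ≤ _ := by gcongr
  have hG : 0 < Real.Gamma c := Real.Gamma_pos_of_pos hc
  rw [norm_mul, h2]
  calc _ ≤ (Real.Gamma c * 2 ^ c * Real.exp (-(π / 3 * |y|))) * (‖τ‖ ^ (-c) * Real.exp (π / 4 * |y|)) := by
        gcongr
    _ = (Real.Gamma c * 2 ^ c * ‖τ‖ ^ (-c)) * (Real.exp (-(π / 3 * |y|)) * Real.exp (π / 4 * |y|)) := by ring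
    _ = _ := by rw [← Real.exp_add]; congr 2; ring

lemma exp_inv (c : ℝ) (hc : 0 < c) (τ : ℂ) (hτ : 0 < τ.re) (harg : |τ.arg| ≤ π / 4) (x : ℝ) (hx : 0 < x) :
    ∫ y : ℝ, (x : ℂ) ^ (-(c + y * Complex.I)) *
      (Complex.Gamma (c + y * Complex.I) * τ ^ (-(c + y * Complex.I))) = 2 * π * Complex.exp (-(τ * x)) := by
  have hτ0 : τ ≠ 0 := by rintro rfl; simp at hτ
  have hm : ∀ s : ℂ, 0 < s.re → mellin (fun t : ℝ => Complex.exp (-(τ * t))) s = Complex.Gamma s * τ ^ (-s) :=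
    fun s hs => by simpa [mellin] using gamma_mellin s τ hs hτ
  have h := mellinInv_mellin_eq c (fun t : ℝ => Complex.exp (-(τ * t))) hx ?_ ?_ (by fun_prop)
  · simp only [mellinInv] at h
    have h' : ∀ y : ℝ, mellin (fun t : ℝ => Complex.exp (-(τ * t))) (c + y * Complex.I) =
      (Complex.Gamma (c + y * Complex.I) * τ ^ (-(c + y * Complex.I))) := fun y => hm _ (by simpa using hc)
    simp only [h', smul_eq_mul] at h
    rw [← h, Complex.real_smul]
    have : (π : ℂ) ≠ 0 := by exact_mod_cast Real.pi_pos.ne'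
    push_cast
    rw [← mul_assoc, mul_one_div_cancel (by simpa using this), one_mul]
  · have := aux_intC c τ (by simpa using hc) hτ
    simpa [MellinConvergent] using this
  · have := gamma_vert_int c hc τ hτ0 harg
    refine this.congr (Eventually.of_forall fun y => ?_)
    exact (hm _ (by simpa using hc)).symm


/-- Euler-Maclaurin term. -/
def uT (n : ℕ) (s : ℂ) : ℂ :=
  (s - 1) * ((n : ℂ) + 1) ^ (-s) - ((n : ℂ) + 1) ^ (1 - s) + ((n : ℂ) + 2) ^ (1 - s)

lemma hasDerivAt_cpow_shift (n : ℕ) (w : ℂ) (y : ℝ) (hy : 0 ≤ y) :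
    HasDerivAt (fun y : ℝ => ((n : ℂ) + 1 + y) ^ w) (w * ((n : ℂ) + 1 + y) ^ (w - 1)) y := by
  have h0 : HasDerivAt (fun y : ℂ => ((n : ℂ) + 1 + y)) 1 (y : ℂ) := (hasDerivAt_id _).const_add _
  have h1 := h0.cpow_const (c := w) (Or.inl (by simp; positivity))
  simpa using h1.comp_ofReal

lemma norm_cpow_shift_le (n : ℕ) (s : ℂ) (hs : 0 < s.re) (y : ℝ) (hy : 0 ≤ y) :
    ‖((n : ℂ) + 1 + y) ^ (-s - 1)‖ ≤ ((n : ℝ) + 1) ^ (-s.re - 1) := by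
  have : ((n : ℂ) + 1 + y) = ((n + 1 + y : ℝ) : ℂ) := by push_cast; ring
  rw [this, Complex.norm_cpow_eq_rpow_re_of_pos (by positivity)]
  simp only [Complex.sub_re, Complex.neg_re, Complex.one_re]
  exact Real.rpow_le_rpow_of_nonpos (by positivity) (by linarith) (by linarith)

lemma uT_bound (n : ℕ) (s : ℂ) (hs : 0 < s.re) :
    ‖uT n s‖ ≤ ‖s - 1‖ * ‖s‖ * ((n : ℝ) + 1) ^ (-s.re - 1) := by
  set B := ((n : ℝ) + 1) ^ (-s.re - 1) with hB
  have hB0 : 0 ≤ B := by positivity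
  have h1 : ∀ y ∈ Set.Icc (0:ℝ) 1, ‖((n : ℂ) + 1 + y) ^ (-s) - ((n : ℂ) + 1) ^ (-s)‖ ≤ ‖s‖ * B := by
    intro y hy
    have := norm_image_sub_le_of_norm_deriv_le_segment' (f := fun y : ℝ => ((n : ℂ) + 1 + y) ^ (-s))
      (f' := fun y : ℝ => (-s) * ((n : ℂ) + 1 + y) ^ (-s - 1)) (a := 0) (b := 1) (C := ‖s‖ * B)
      (fun x hx => (hasDerivAt_cpow_shift n (-s) x hx.1).hasDerivWithinAt)
      (fun x hx => by
        rw [norm_mul, norm_neg]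
        gcongr
        exact norm_cpow_shift_le n s hs x hx.1) y hy
    simp only [Complex.ofReal_zero, add_zero, sub_zero] at this
    refine this.trans ?_
    exact mul_le_of_le_one_right (by positivity) hy.2
  have h2 := norm_image_sub_le_of_norm_deriv_le_segment'
      (f := fun y : ℝ => ((n : ℂ) + 1 + y) ^ (1 - s) - (1 - s) * ((n : ℂ) + 1) ^ (-s) * y)
      (f' := fun y : ℝ => (1 - s) * (((n : ℂ) + 1 + y) ^ (-s) - ((n : ℂ) + 1) ^ (-s)))
      (a := 0) (b := 1) (C := ‖s - 1‖ * (‖s‖ * B))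
      (fun x hx => by
        have e1 := hasDerivAt_cpow_shift n (1 - s) x hx.1
        have e2 : HasDerivAt (fun y : ℝ => (1 - s) * ((n : ℂ) + 1) ^ (-s) * (y : ℂ))
          ((1 - s) * ((n : ℂ) + 1) ^ (-s) * 1) x := (Complex.ofRealCLM.hasDerivAt (x := x)).const_mul _
        have e3 := (e1.fun_sub e2).hasDerivWithinAt (s := Set.Icc 0 1)
        convert e3 using 1
        rw [show (1 - s - 1 : ℂ) = -s by ring]; ring)
      (fun x hx => by
        rw [norm_mul, ← norm_neg (1 - s), neg_sub]
        gcongr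
        exact h1 x ⟨hx.1, hx.2.le⟩) 1 ⟨zero_le_one, le_rfl⟩
  simp only [Complex.ofReal_zero, add_zero, sub_zero, mul_one, mul_zero, Complex.ofReal_one] at h2
  rw [mul_assoc]
  refine le_trans (le_of_eq ?_) h2
  rw [uT, show (n : ℂ) + 1 + 1 = n + 2 by ring]
  congr 1
  ring

lemma summable_shift (p : ℝ) (hp : p < -1) : Summable (fun n : ℕ => ((n : ℝ) + 1) ^ p) := by
  have := (summable_nat_add_iff 1).2 (Real.summable_nat_rpow.2 hp)
  simpa using this

lemma uT_diff : DifferentiableOn ℂ (fun s => ∑' n, uT n s) {s : ℂ | 0 < s.re} := by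
  intro s hs
  have hs' : 0 < s.re := hs
  set U : Set ℂ := {z : ℂ | s.re / 2 < z.re} ∩ Metric.ball 0 (‖s‖ + 1) with hU
  have hUo : IsOpen U := (isOpen_lt continuous_const Complex.continuous_re).inter Metric.isOpen_ball
  have hsU : s ∈ U := ⟨by simp; linarith, by simp⟩
  refine DifferentiableAt.differentiableWithinAt ?_
  refine (Complex.differentiableOn_tsum_of_summable_norm
    (u := fun n : ℕ => (‖s‖ + 2) * (‖s‖ + 1) * ((n : ℝ) + 1) ^ (-(s.re / 2) - 1))
    ((summable_shift _ (by linarith)).mul_left _) ?_ hUo ?_).differentiableAt (hUo.mem_nhds hsU)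
  · intro n
    unfold uT
    have hn1 : ((n : ℂ) + 1) ≠ 0 := by exact_mod_cast n.succ_ne_zero
    have hn2 : ((n : ℂ) + 2) ≠ 0 := by exact_mod_cast (n + 1).succ_ne_zero
    intro z _
    refine DifferentiableAt.differentiableWithinAt ?_
    refine ((DifferentiableAt.mul (by fun_prop) ?_).sub ?_).add ?_
    · exact DifferentiableAt.const_cpow (by fun_prop) (Or.inl hn1)
    · exact DifferentiableAt.const_cpow (by fun_prop) (Or.inl hn1)
    · exact DifferentiableAt.const_cpow (by fun_prop) (Or.inl hn2)
  · intro n z hz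
    have hz1 : s.re / 2 < z.re := hz.1
    have hz2 : ‖z‖ < ‖s‖ + 1 := by simpa using hz.2
    refine (uT_bound n z (by linarith)).trans ?_
    have : ‖z - 1‖ ≤ ‖s‖ + 2 := by
      have := norm_sub_le z 1
      simp at this; linarith
    gcongr
    simp

lemma uT_sum_gt (s : ℂ) (hs : 1 < s.re) : ∑' n, uT n s = riemannZeta₁ s - 1 := by
  have hs1 : s ≠ 1 := by rintro rfl; simp at hs
  have hz : HasSum (fun n : ℕ => ((n : ℂ) + 1) ^ (-s)) (riemannZeta s) := by
    have h1 := zeta_eq_tsum_one_div_nat_add_one_cpow hs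
    have h2 : Summable (fun n : ℕ => 1 / ((n : ℂ) + 1) ^ s) := by
      have := (summable_nat_add_iff 1).2 (Complex.summable_one_div_nat_cpow.2 hs)
      simpa using this
    have h3 := h2.hasSum
    rw [← h1] at h3
    refine h3.congr_fun ?_ |> fun h => h
    intro n
    rw [Complex.cpow_neg, one_div]
  have ht : Tendsto (fun n : ℕ => ((n : ℂ) + 1) ^ (1 - s)) atTop (𝓝 0) := by
    rw [tendsto_zero_iff_norm_tendsto_zero]
    have e : ∀ n : ℕ, ‖((n : ℂ) + 1) ^ (1 - s)‖ = ((n : ℝ) + 1) ^ (-(s.re - 1)) := by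
      intro n
      have : ((n : ℂ) + 1) = ((n + 1 : ℝ) : ℂ) := by push_cast; ring
      rw [this, Complex.norm_cpow_eq_rpow_re_of_pos (by positivity)]
      simp
    simp only [e]
    exact (tendsto_rpow_neg_atTop (by linarith)).comp (tendsto_atTop_add_const_right _ _ tendsto_natCast_atTop_atTop)
  have htel : HasSum (fun n : ℕ => ((n : ℂ) + 2) ^ (1 - s) - ((n : ℂ) + 1) ^ (1 - s)) (-1) := by
    have hsum : Summable (fun n : ℕ => ((n : ℂ) + 2) ^ (1 - s) - ((n : ℂ) + 1) ^ (1 - s)) := by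
      have h1 : Summable (fun n : ℕ => uT n s) := by
        refine Summable.of_norm_bounded ((summable_shift (-s.re - 1) (by linarith)).mul_left (‖s - 1‖ * ‖s‖)) ?_
        intro n
        exact uT_bound n s (by linarith)
      refine (h1.sub (hz.summable.mul_left (s - 1))).congr fun n => ?_
      unfold uT; ring
    refine (hsum.hasSum_iff_tendsto_nat).2 ?_
    have e : ∀ N : ℕ, ∑ n ∈ Finset.range N, (((n : ℂ) + 2) ^ (1 - s) - ((n : ℂ) + 1) ^ (1 - s)) =
        ((N : ℂ) + 1) ^ (1 - s) - 1 := by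
      intro N
      have := Finset.sum_range_sub (fun n : ℕ => ((n : ℂ) + 1) ^ (1 - s)) N
      simp only [Nat.cast_add, Nat.cast_one, Nat.cast_zero, zero_add, Complex.one_cpow] at this
      rw [← this]
      refine Finset.sum_congr rfl fun n _ => ?_
      rw [show (n : ℂ) + 1 + 1 = n + 2 by ring]
    simp only [e]
    simpa using ht.sub_const 1
  have := (hz.mul_left (s - 1)).add htel
  have h2 : HasSum (fun n => uT n s) ((s - 1) * riemannZeta s + -1) := by
    refine this.congr_fun ?_ |> fun h => h
    intro n
    unfold uT; ring
  rw [h2.tsum_eq, riemannZeta_eq_inv_sub_mul hs1, ← mul_assoc, mul_inv_cancel₀ (sub_ne_zero.2 hs1)]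
  ring

lemma uT_sum (s : ℂ) (hs : 0 < s.re) : ∑' n, uT n s = riemannZeta₁ s - 1 := by
  have hopen : IsOpen {z : ℂ | 0 < z.re} := isOpen_lt continuous_const Complex.continuous_re
  have hf := uT_diff.analyticOnNhd hopen
  have hg : AnalyticOnNhd ℂ (fun s => riemannZeta₁ s - 1) {z : ℂ | 0 < z.re} :=
    DifferentiableOn.analyticOnNhd (differentiable_riemannZeta₁.sub_const 1).differentiableOn hopen
  refine hf.eqOn_of_preconnected_of_eventuallyEq hg (convex_halfSpace_re_gt 0).isPreconnected
    (z₀ := 2) (by simp) ?_ hs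
  filter_upwards [(isOpen_lt continuous_const Complex.continuous_re).mem_nhds
    (show (2:ℂ) ∈ {z : ℂ | 1 < z.re} by simp)] with z hz
  exact uT_sum_gt z hz

lemma zeta1_bound (σ : ℝ) (hσ : 0 < σ) : ∃ C : ℝ, 0 < C ∧ ∀ s : ℂ, σ ≤ s.re →
    ‖riemannZeta₁ s‖ ≤ 1 + C * ‖s - 1‖ * ‖s‖ := by
  have hsum := summable_shift (-σ - 1) (by linarith)
  refine ⟨∑' n : ℕ, ((n : ℝ) + 1) ^ (-σ - 1), hsum.tsum_pos (fun n => by positivity) 0 (by positivity), fun s hs => ?_⟩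
  have h := uT_sum s (by linarith)
  have : riemannZeta₁ s = 1 + ∑' n, uT n s := by rw [h]; ring
  rw [this]
  refine (norm_add_le _ _).trans ?_
  rw [norm_one]
  gcongr
  have h2 : ∀ n : ℕ, ‖uT n s‖ ≤ ‖s - 1‖ * ‖s‖ * ((n : ℝ) + 1) ^ (-σ - 1) := fun n => by
    refine (uT_bound n s (by linarith)).trans ?_
    gcongr
    simp
  refine (tsum_of_norm_bounded (hsum.mul_left (‖s - 1‖ * ‖s‖)).hasSum h2).trans (le_of_eq ?_)
  rw [tsum_mul_left]; ring


lemma vert_one (a : ℝ) (ha : a ≠ 0) (T : ℝ) :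
    ∫ y in (-T)..T, 1 / ((a : ℂ) + y * Complex.I) = ((2 * Real.arctan (T / a) : ℝ) : ℂ) := by
  have hne : ∀ y : ℝ, (a : ℂ) + y * Complex.I ≠ 0 := fun y h => ha (by simpa using congrArg Complex.re h)
  have hd : ∀ y : ℝ, HasDerivAt (fun y : ℝ => ((Real.arctan (y / a) : ℝ) : ℂ) -
      Complex.I / 2 * ((Real.log (a ^ 2 + y ^ 2) : ℝ) : ℂ)) (1 / ((a : ℂ) + y * Complex.I)) y := by
    intro y
    have hpos : 0 < a ^ 2 + y ^ 2 := by positivity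
    have h1 : HasDerivAt (fun y : ℝ => Real.arctan (y / a)) (1 / (1 + (y / a) ^ 2) * (1 / a)) y :=
      ((hasDerivAt_id y).div_const a).arctan
    have h2 : HasDerivAt (fun y : ℝ => Real.log (a ^ 2 + y ^ 2)) ((2 * y) / (a ^ 2 + y ^ 2)) y := by
      have : HasDerivAt (fun y : ℝ => a ^ 2 + y ^ 2) (2 * y) y := by
        simpa using (hasDerivAt_pow 2 y).const_add (a ^ 2)
      exact this.log hpos.ne'
    have h3 := h1.ofReal_comp.fun_sub (h2.ofReal_comp.const_mul (Complex.I / 2))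
    refine h3.congr_deriv ?_
    symm
    have ha' : (a : ℂ) ≠ 0 := by exact_mod_cast ha
    have hpos' : (a : ℂ) ^ 2 + (y : ℂ) ^ 2 ≠ 0 := by exact_mod_cast hpos.ne'
    have e1 : (1 / (1 + (y / a) ^ 2) * (1 / a) : ℝ) = a / (a ^ 2 + y ^ 2) := by
      field_simp
    rw [e1]
    push_cast
    have hy := hne y
    rw [div_eq_iff hy]
    field_simp
    linear_combination ((y:ℂ) ^ 2) * Complex.I_sq
  have hc : Continuous (fun y : ℝ => 1 / ((a : ℂ) + y * Complex.I)) :=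
    Continuous.div (by fun_prop) (by fun_prop) hne
  rw [intervalIntegral.integral_eq_sub_of_hasDerivAt (fun y _ => hd y) (hc.intervalIntegrable _ _)]
  rw [neg_div, Real.arctan_neg, neg_sq]
  push_cast
  ring

lemma vert_one_pos (a : ℝ) (ha : 0 < a) :
    Tendsto (fun T : ℝ => ∫ y in (-T)..T, 1 / ((a : ℂ) + y * Complex.I)) atTop (𝓝 (π : ℂ)) := by
  simp only [vert_one a ha.ne']
  have h : Tendsto (fun T : ℝ => 2 * Real.arctan (T / a)) atTop (𝓝 (2 * (π / 2))) :=
    ((tendsto_nhds_of_tendsto_nhdsWithin Real.tendsto_arctan_atTop).comp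
      (tendsto_id.atTop_div_const ha)).const_mul 2
  have h2 := (Complex.continuous_ofReal.tendsto _).comp h
  rw [mul_div_cancel₀ _ two_ne_zero] at h2
  exact h2

lemma vert_one_neg (a : ℝ) (ha : a < 0) :
    Tendsto (fun T : ℝ => ∫ y in (-T)..T, 1 / ((a : ℂ) + y * Complex.I)) atTop (𝓝 (-π : ℂ)) := by
  have h := (vert_one_pos (-a) (by linarith)).neg
  refine h.congr fun T => ?_
  rw [vert_one a ha.ne, vert_one (-a) (by linarith), div_neg, Real.arctan_neg]
  push_cast; ring

lemma inv_vert_tendsto (a : ℝ) : Tendsto (fun T : ℝ => Complex.I / ((a : ℂ) + T * Complex.I)) atTop (𝓝 0) := by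
  rw [tendsto_zero_iff_norm_tendsto_zero]
  refine squeeze_zero' (g := fun T : ℝ => 1 / T) (Eventually.of_forall fun T => norm_nonneg _) ?_ ?_
  · filter_upwards [eventually_gt_atTop 0] with T hT
    rw [norm_div, Complex.norm_I]
    have := Complex.abs_im_le_norm ((a : ℂ) + T * Complex.I)
    simp at this
    rw [abs_of_pos hT] at this
    gcongr
  · simpa using tendsto_inv_atTop_zero (𝕜 := ℝ)

lemma vert_two (a : ℝ) (ha : a ≠ 0) :
    Tendsto (fun T : ℝ => ∫ y in (-T)..T, 1 / ((a : ℂ) + y * Complex.I) ^ 2) atTop (𝓝 0) := by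
  have hne : ∀ y : ℝ, (a : ℂ) + y * Complex.I ≠ 0 := fun y h => ha (by simpa using congrArg Complex.re h)
  have hd : ∀ y : ℝ, HasDerivAt (fun y : ℝ => Complex.I / ((a : ℂ) + y * Complex.I))
      (1 / ((a : ℂ) + y * Complex.I) ^ 2) y := by
    intro y
    have h1 : HasDerivAt (fun y : ℝ => (a : ℂ) + y * Complex.I) Complex.I y := by
      simpa using ((Complex.ofRealCLM.hasDerivAt (x := y)).mul_const Complex.I).const_add (a : ℂ)
    have h2 := (hasDerivAt_const y Complex.I).fun_div h1 (hne y)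
    refine h2.congr_deriv ?_
    simp
  have hc : Continuous (fun y : ℝ => 1 / ((a : ℂ) + y * Complex.I) ^ 2) :=
    Continuous.div (by fun_prop) (by fun_prop) fun y => pow_ne_zero 2 (hne y)
  have e : ∀ T : ℝ, ∫ y in (-T)..T, 1 / ((a : ℂ) + y * Complex.I) ^ 2 =
      Complex.I / ((a : ℂ) + T * Complex.I) + Complex.I / (((-a : ℝ) : ℂ) + T * Complex.I) := by
    intro T
    rw [intervalIntegral.integral_eq_sub_of_hasDerivAt (fun y _ => hd y) (hc.intervalIntegrable _ _), sub_eq_add_neg]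
    congr 1
    rw [← div_neg]
    congr 1
    push_cast; ring
  simp only [e]
  simpa using (inv_vert_tendsto a).add (inv_vert_tendsto (-a))

lemma dslope_diff (N : ℂ → ℂ) (C₀ : ℝ) (p : ℂ) (hp : -C₀ < p.re)
    (hN : ∀ s : ℂ, -C₀ ≤ s.re → DifferentiableAt ℂ N s) :
    ∀ s : ℂ, -C₀ ≤ s.re → DifferentiableAt ℂ (dslope N p) s := by
  intro s hs
  by_cases h : s = p
  · subst h
    have hU : {z : ℂ | -C₀ < z.re} ∈ 𝓝 s := (isOpen_lt continuous_const Complex.continuous_re).mem_nhds hp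
    refine ((Complex.differentiableOn_dslope hU).2 fun z hz => ?_).differentiableAt hU
    have hz' : -C₀ < z.re := hz
    exact (hN z hz'.le).differentiableWithinAt
  · exact (differentiableAt_dslope_of_ne h).2 (hN s hs)

lemma contour (N : ℂ → ℂ) (ρ C₀ c : ℝ) (hC : 0 < C₀) (hρ : 0 < ρ) (hc : ρ < c)
    (hN : ∀ s : ℂ, -C₀ ≤ s.re → DifferentiableAt ℂ N s)
    (g : ℝ → ℝ) (hg : Tendsto g atTop (𝓝 0)) (T₀ : ℝ)
    (hdec : ∀ s : ℂ, -C₀ ≤ s.re → s.re ≤ c → T₀ ≤ |s.im| → ‖N s / (s ^ 2 * (s - ρ))‖ ≤ g |s.im|)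
    (hI1 : Integrable (fun y : ℝ => N (c + y * Complex.I) /
      ((c + y * Complex.I) ^ 2 * (c + y * Complex.I - ρ))))
    (hI2 : Integrable (fun y : ℝ => N ((-C₀ : ℝ) + y * Complex.I) /
      (((-C₀ : ℝ) + y * Complex.I) ^ 2 * ((-C₀ : ℝ) + y * Complex.I - ρ)))) :
    (∫ y : ℝ, N (c + y * Complex.I) / ((c + y * Complex.I) ^ 2 * (c + y * Complex.I - ρ))) -
    (∫ y : ℝ, N ((-C₀ : ℝ) + y * Complex.I) /
      (((-C₀ : ℝ) + y * Complex.I) ^ 2 * ((-C₀ : ℝ) + y * Complex.I - ρ))) =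
    2 * π * deriv (dslope N ρ) 0 := by
  have hρ' : (ρ : ℂ) ≠ 0 := by exact_mod_cast hρ.ne'
  set N1 := dslope N ρ with hN1
  set N2 := dslope N1 0 with hN2
  set N3 := dslope N2 0 with hN3
  have d1 := dslope_diff N C₀ ρ (by simp; linarith) hN
  have d2 := dslope_diff N1 C₀ 0 (by simp; linarith) d1
  have d3 := dslope_diff N2 C₀ 0 (by simp; linarith) d2
  set r1 : ℂ := N ρ / ρ ^ 2 with hr1
  set r0 : ℂ := N2 0 - N ρ / ρ ^ 2 with hr0
  set q : ℂ := N1 0 - N ρ / ρ with hq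
  have hE : ∀ s : ℂ, s ≠ 0 → s ≠ ρ →
      N3 s = N s / (s ^ 2 * (s - ρ)) - (r1 * (1 / (s - ρ)) + r0 * (1 / s) + q * (1 / s ^ 2)) := by
    intro s h0 h1
    have h1' : s - ρ ≠ 0 := sub_ne_zero.2 h1
    have e3 : N3 s = (N2 s - N2 0) / s := by
      rw [hN3, dslope_of_ne _ h0, slope_def_field, sub_zero]
    have e2 : N2 s = (N1 s - N1 0) / s := by
      rw [hN2, dslope_of_ne _ h0, slope_def_field, sub_zero]
    have e1 : N1 s = (N s - N ρ) / (s - ρ) := by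
      rw [hN1, dslope_of_ne _ h1, slope_def_field]
    rw [e3, e2, e1, hr1, hr0, hq]
    field_simp
    ring
  -- vertical lines
  have key : ∀ a : ℝ, a ≠ 0 → a ≠ ρ →
      Integrable (fun y : ℝ => N (a + y * Complex.I) / ((a + y * Complex.I) ^ 2 * (a + y * Complex.I - ρ))) →
      ∀ l1 l0 : ℂ, Tendsto (fun T : ℝ => ∫ y in (-T)..T, 1 / (((a - ρ : ℝ) : ℂ) + y * Complex.I)) atTop (𝓝 l1) →
      Tendsto (fun T : ℝ => ∫ y in (-T)..T, 1 / ((a : ℂ) + y * Complex.I)) atTop (𝓝 l0) →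
      Tendsto (fun T : ℝ => ∫ y in (-T)..T, N3 (a + y * Complex.I)) atTop
        (𝓝 ((∫ y : ℝ, N (a + y * Complex.I) / ((a + y * Complex.I) ^ 2 * (a + y * Complex.I - ρ))) -
          (r1 * l1 + r0 * l0 + q * 0))) := by
    intro a ha0 haρ hIntg l1 l0 ht1 ht0
    have hne : ∀ y : ℝ, (a : ℂ) + y * Complex.I ≠ 0 := fun y h => ha0 (by simpa using congrArg Complex.re h)
    have haρ' : a - ρ ≠ 0 := sub_ne_zero.2 haρ
    have hne' : ∀ y : ℝ, ((a - ρ : ℝ) : ℂ) + y * Complex.I ≠ 0 :=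
      fun y h => haρ' (by simpa using congrArg Complex.re h)
    have hc1 : Continuous (fun y : ℝ => 1 / (((a - ρ : ℝ) : ℂ) + y * Complex.I)) :=
      Continuous.div (by fun_prop) (by fun_prop) hne'
    have hc0 : Continuous (fun y : ℝ => 1 / ((a : ℂ) + y * Complex.I)) :=
      Continuous.div (by fun_prop) (by fun_prop) hne
    have hc2 : Continuous (fun y : ℝ => 1 / ((a : ℂ) + y * Complex.I) ^ 2) :=
      Continuous.div (by fun_prop) (by fun_prop) fun y => pow_ne_zero 2 (hne y)
    have hT := (intervalIntegral_tendsto_integral hIntg tendsto_neg_atTop_atBot tendsto_id).sub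
      (((ht1.const_mul r1).add (ht0.const_mul r0)).add ((vert_two a ha0).const_mul q))
    refine hT.congr fun T => ?_
    simp only [id]
    rw [← intervalIntegral.integral_const_mul, ← intervalIntegral.integral_const_mul,
      ← intervalIntegral.integral_const_mul,
      ← intervalIntegral.integral_add ((hc1.const_mul r1).intervalIntegrable _ _) ((hc0.const_mul r0).intervalIntegrable _ _),
      ← intervalIntegral.integral_add (((hc1.const_mul r1).fun_add (hc0.const_mul r0)).intervalIntegrable _ _)
        ((hc2.const_mul q).intervalIntegrable _ _),
      ← intervalIntegral.integral_sub hIntg.intervalIntegrable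
        ((((hc1.const_mul r1).fun_add (hc0.const_mul r0)).fun_add (hc2.const_mul q)).intervalIntegrable _ _)]
    refine intervalIntegral.integral_congr fun y _ => ?_
    have h2 : (a : ℂ) + y * Complex.I - ρ = ((a - ρ : ℝ) : ℂ) + y * Complex.I := by push_cast; ring
    have := hE (a + y * Complex.I) (hne y) (by rw [← sub_ne_zero, h2]; exact hne' y)
    rw [this, h2]
  have kc := key c (by linarith) (by linarith) hI1 _ _ (vert_one_pos (c - ρ) (by linarith)) (vert_one_pos c (by linarith))
  have kC := key (-C₀) (by linarith) (by linarith) hI2 _ _ (vert_one_neg (-C₀ - ρ) (by linarith)) (vert_one_neg (-C₀) (by linarith))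
  -- horizontal lines
  set G : ℝ → ℝ := fun T => g T + (‖r1‖ * (1 / T) + ‖r0‖ * (1 / T) + ‖q‖ * (1 / T ^ 2)) with hG
  have hG0 : Tendsto G atTop (𝓝 0) := by
    have i1 : Tendsto (fun T : ℝ => 1 / T) atTop (𝓝 0) := by simpa using tendsto_inv_atTop_zero (𝕜 := ℝ)
    have i2 : Tendsto (fun T : ℝ => 1 / T ^ 2) atTop (𝓝 0) := by
      simpa [Function.comp_def] using (tendsto_inv_atTop_zero (𝕜 := ℝ)).comp (tendsto_pow_atTop (two_ne_zero))
    simpa [hG] using hg.add (((i1.const_mul ‖r1‖).add (i1.const_mul ‖r0‖)).add (i2.const_mul ‖q‖))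
  have hb : ∀ s : ℂ, -C₀ ≤ s.re → s.re ≤ c → T₀ ≤ |s.im| → 0 < |s.im| → ‖N3 s‖ ≤ G |s.im| := by
    intro s h1 h2 h3 h4
    have him : s.im ≠ 0 := abs_pos.1 h4
    have hs0 : s ≠ 0 := by rintro rfl; simp at him
    have hsρ : s ≠ ρ := by rintro rfl; simp at him
    have n1 : |s.im| ≤ ‖s‖ := Complex.abs_im_le_norm s
    have n2 : |s.im| ≤ ‖s - ρ‖ := by simpa using Complex.abs_im_le_norm (s - ρ)
    rw [hE s hs0 hsρ, hG]
    refine (norm_sub_le _ _).trans (add_le_add (hdec s h1 h2 h3) ?_)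
    refine (norm_add_le _ _).trans (add_le_add ((norm_add_le _ _).trans (add_le_add ?_ ?_)) ?_)
    · rw [norm_mul, one_div, norm_inv, one_div]
      gcongr
    · rw [norm_mul, one_div, norm_inv, one_div]
      gcongr
    · rw [norm_mul, one_div, norm_inv, norm_pow, one_div]
      gcongr
  have hH : ∀ ε : ℝ, (ε = 1 ∨ ε = -1) → Tendsto (fun T : ℝ => ∫ x in (-C₀)..c, N3 (x + ((ε * T : ℝ) : ℂ) * Complex.I)) atTop (𝓝 0) := by
    intro ε hε
    rw [tendsto_zero_iff_norm_tendsto_zero]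
    have hz : Tendsto (fun T => G T * |c - -C₀|) atTop (𝓝 0) := by simpa using hG0.mul_const |c - -C₀|
    refine squeeze_zero' (Eventually.of_forall fun T => norm_nonneg _) ?_ hz
    filter_upwards [eventually_gt_atTop 0, eventually_ge_atTop T₀] with T hT hT0
    refine intervalIntegral.norm_integral_le_of_norm_le_const fun x hx => ?_
    rw [Set.uIoc_of_le (by linarith)] at hx
    have him : |((x : ℂ) + ((ε * T : ℝ) : ℂ) * Complex.I).im| = T := by
      rcases hε with rfl | rfl <;> simp [abs_of_pos hT]
    have hre : ((x : ℂ) + ((ε * T : ℝ) : ℂ) * Complex.I).re = x := by simp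
    have := hb (x + ((ε * T : ℝ) : ℂ) * Complex.I) (by rw [hre]; exact hx.1.le) (by rw [hre]; exact hx.2)
      (by rw [him]; exact hT0) (by rw [him]; exact hT)
    rwa [him] at this
  have hrect : ∀ T : ℝ, (∫ y in (-T)..T, N3 (c + y * Complex.I)) - (∫ y in (-T)..T, N3 ((-C₀ : ℝ) + y * Complex.I))
      = Complex.I * ((∫ x in (-C₀)..c, N3 (x + ((-1 * T : ℝ) : ℂ) * Complex.I)) -
         (∫ x in (-C₀)..c, N3 (x + ((1 * T : ℝ) : ℂ) * Complex.I))) := by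
    intro T
    have := Complex.integral_boundary_rect_eq_zero_of_differentiableOn N3 ⟨-C₀, -T⟩ ⟨c, T⟩ (by
      intro s hs
      refine (d3 s ?_).differentiableWithinAt
      have := hs.1
      simp only [Set.mem_preimage] at this
      rw [Set.uIcc_of_le (by linarith)] at this
      exact this.1)
    simp only [smul_eq_mul] at this
    rw [neg_one_mul, one_mul]
    linear_combination (-Complex.I) * this + ((∫ y in (-T)..T, N3 (c + y * Complex.I)) - (∫ y in (-T)..T, N3 ((-C₀ : ℝ) + y * Complex.I))) * Complex.I_sq
  have hlim := kc.sub kC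
  have hlim2 : Tendsto (fun T : ℝ => (∫ y in (-T)..T, N3 (c + y * Complex.I)) -
      (∫ y in (-T)..T, N3 ((-C₀ : ℝ) + y * Complex.I))) atTop (𝓝 (Complex.I * (0 - 0))) := by
    simp only [hrect]
    exact ((hH (-1) (Or.inr rfl)).sub (hH 1 (Or.inl rfl))).const_mul _
  have hu := tendsto_nhds_unique hlim hlim2
  have hd : deriv N1 0 = r1 + r0 := by
    rw [hr1, hr0, hN2, dslope_same]; ring
  rw [hd]
  linear_combination hu


lemma hasSum_prod_mul (f g : ℕ → ℂ) (a b : ℂ) (hf : HasSum f a) (hg : HasSum g b) :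
    HasSum (fun i : ℕ × ℕ => f i.1 * g i.2) (a * b) :=
  hf.mul hg (summable_mul_of_summable_norm hf.summable.norm hg.summable.norm)

lemma zeta_hasSum (s : ℂ) (hs : 0 < s.re) :
    HasSum (fun m : ℕ => ((m : ℂ) + 1) ^ (-s - 1)) (riemannZeta (s + 1)) := by
  have hs1 : 1 < (s + 1).re := by rw [Complex.add_re]; simp [hs]
  have e1 := zeta_eq_tsum_one_div_nat_add_one_cpow hs1
  have e2 : Summable (fun n : ℕ => 1 / ((n : ℂ) + 1) ^ (s + 1)) := by
    have := (summable_nat_add_iff 1).2 (Complex.summable_one_div_nat_cpow.2 hs1)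
    simpa using this
  have e3 := e2.hasSum
  rw [← e1] at e3
  refine e3.congr_fun ?_ |> fun h => h
  intro n
  rw [one_div, ← Complex.cpow_neg]
  congr 1; ring

lemma pt_sum (b : ℕ → ℝ) (s : ℂ) (hs : 0 < s.re) (d : ℂ)
    (h1 : HasSum (fun k : ℕ => (b (k + 1) : ℂ) * ((k + 1 : ℕ) : ℂ) ^ (-s)) d) (w : ℂ) :
    HasSum (fun i : ℕ × ℕ => ((b (i.1 + 1) / ((i.2 : ℝ) + 1) : ℝ) : ℂ) *
      (((((i.1 : ℝ) + 1) * ((i.2 : ℝ) + 1) : ℝ) : ℂ) ^ (-s) * w)) (d * riemannZeta (s + 1) * w) := by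
  have h3 := (hasSum_prod_mul _ _ _ _ h1 (zeta_hasSum s hs)).mul_right w
  refine h3.congr_fun ?_ |> fun h => h
  intro i
  have hm : ((i.2 : ℂ) + 1) ≠ 0 := by exact_mod_cast i.2.succ_ne_zero
  rw [Complex.ofReal_mul, Complex.mul_cpow_ofReal_nonneg (by positivity) (by positivity)]
  rw [Complex.cpow_sub _ _ hm, Complex.cpow_one]
  push_cast
  ring

lemma FbC_int (b : ℕ → ℝ) (hb : ∀ k, 0 ≤ b k) (c : ℝ) (hc : 0 < c) (Dc : ℂ → ℂ)
    (hD : ∀ s : ℂ, s.re = c →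
      HasSum (fun k : ℕ => (b (k + 1) : ℂ) * ((k + 1 : ℕ) : ℂ) ^ (-s)) (Dc s))
    (τ : ℂ) (hτ : 0 < τ.re) (harg : |τ.arg| ≤ π / 4) :
    2 * π * FbC b (Complex.exp (-τ)) = ∫ y : ℝ, Complex.Gamma (c + y * Complex.I) *
      riemannZeta (c + y * Complex.I + 1) * Dc (c + y * Complex.I) * τ ^ (-(c + y * Complex.I)) := by
  have hτ0 : τ ≠ 0 := by rintro rfl; simp at hτ
  set g : ℝ → ℂ := fun y => Complex.Gamma (c + y * Complex.I) * τ ^ (-(c + y * Complex.I)) with hg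
  have hgi : Integrable g := gamma_vert_int c hc τ hτ0 harg
  have hgc : Continuous g := gamma_vert_cont c hc τ hτ0
  set X : ℕ × ℕ → ℝ := fun i => ((i.1 : ℝ) + 1) * ((i.2 : ℝ) + 1) with hX
  have hX0 : ∀ i, 0 < X i := fun i => by simp only [hX]; positivity
  set F : ℕ × ℕ → ℝ → ℂ := fun i y => ((b (i.1 + 1) / ((i.2 : ℝ) + 1) : ℝ) : ℂ) *
    ((X i : ℂ) ^ (-(c + y * Complex.I)) * g y) with hF
  have hFn : ∀ i y, ‖F i y‖ = b (i.1 + 1) / ((i.2 : ℝ) + 1) * X i ^ (-c) * ‖g y‖ := by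
    intro i y
    simp only [hF]
    rw [norm_mul, norm_mul, Complex.norm_cpow_eq_rpow_re_of_pos (hX0 i), Complex.norm_real,
      Real.norm_of_nonneg (div_nonneg (hb _) (by positivity))]
    simp [mul_assoc]
  have hFc : ∀ i, Continuous (F i) := by
    intro i
    refine continuous_const.mul (Continuous.mul ?_ hgc)
    exact Continuous.const_cpow (by fun_prop) (Or.inl (by exact_mod_cast (hX0 i).ne'))
  have hFi : ∀ i, Integrable (F i) := by
    intro i
    refine (hgi.norm.const_mul (b (i.1 + 1) / ((i.2 : ℝ) + 1) * X i ^ (-c))).mono' (hFc i).aestronglyMeasurable ?_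
    exact Eventually.of_forall fun y => (hFn i y).le
  have hsb : Summable (fun k : ℕ => b (k + 1) * ((k : ℝ) + 1) ^ (-c)) := by
    have h := (hD c (by simp)).summable.norm
    refine h.congr fun k => ?_
    rw [norm_mul, Complex.norm_real, Real.norm_of_nonneg (hb _), Complex.norm_natCast_cpow_of_pos (Nat.succ_pos k)]
    simp
  have hsz : Summable (fun m : ℕ => ((m : ℝ) + 1) ^ (-c - 1)) := summable_shift _ (by linarith)
  have hprod : ∀ i : ℕ × ℕ, b (i.1 + 1) / ((i.2 : ℝ) + 1) * X i ^ (-c) =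
      (b (i.1 + 1) * ((i.1 : ℝ) + 1) ^ (-c)) * ((i.2 : ℝ) + 1) ^ (-c - 1) := by
    intro i
    simp only [hX]
    rw [Real.mul_rpow (by positivity) (by positivity), Real.rpow_sub_one (by positivity)]
    ring
  have hS : Summable (fun i => ∫ y, ‖F i y‖) := by
    have h1 : Summable (fun i : ℕ × ℕ => (b (i.1 + 1) * ((i.1 : ℝ) + 1) ^ (-c)) * ((i.2 : ℝ) + 1) ^ (-c - 1)) :=
      hsb.mul_of_nonneg hsz (fun k => mul_nonneg (hb _) (by positivity)) (fun m => by positivity)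
    refine (h1.mul_right (∫ y, ‖g y‖)).congr fun i => ?_
    simp only [hFn]
    rw [integral_const_mul, hprod]
  have hmain := hasSum_integral_of_summable_integral_norm hFi hS
  -- pointwise sum
  have hpt : ∀ y : ℝ, ∑' i, F i y = Complex.Gamma (c + y * Complex.I) *
      riemannZeta (c + y * Complex.I + 1) * Dc (c + y * Complex.I) * τ ^ (-(c + y * Complex.I)) := by
    intro y
    have h5 : HasSum (fun i => F i y) (Dc (c + y * Complex.I) * riemannZeta (c + y * Complex.I + 1) * g y) :=
      pt_sum b (c + y * Complex.I) (by simpa using hc) _ (hD _ (by simp)) (g y)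
    rw [h5.tsum_eq]
    simp only [hg]
    ring
  simp only [hpt] at hmain
  have hterm : ∀ i, ∫ y, F i y = ((b (i.1 + 1) / ((i.2 : ℝ) + 1) : ℝ) : ℂ) *
      (2 * π * Complex.exp (-(τ * X i))) := by
    intro i
    simp only [hF]
    rw [integral_const_mul]
    congr 1
    exact exp_inv c hc τ hτ harg (X i) (hX0 i)
  simp only [hterm] at hmain
  have hfib := hmain.prod_fiberwise (g := fun k : ℕ => 2 * π * ((b (k + 1) : ℂ) *
      (-Complex.log (1 - Complex.exp (-τ) ^ (k + 1))))) (fun k => by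
    have hz : ‖Complex.exp (-τ) ^ (k + 1)‖ < 1 := by
      rw [norm_pow, Complex.norm_exp]
      refine pow_lt_one₀ (Real.exp_pos _).le ?_ (Nat.succ_ne_zero k)
      simpa using hτ
    have h1 := (hasSum_nat_add_iff' 1).2 (Complex.hasSum_taylorSeries_neg_log hz)
    simp only [Finset.range_one, Finset.sum_singleton, pow_zero, Nat.cast_zero, div_zero, sub_zero] at h1
    have h2 := (h1.mul_left (b (k + 1) : ℂ)).mul_left (2 * π : ℂ)
    refine h2.congr_fun ?_ |> fun h => h
    intro m
    have : Complex.exp (-(τ * X (k, m))) = (Complex.exp (-τ) ^ (k + 1)) ^ (m + 1) := by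
      rw [← Complex.exp_nat_mul, ← Complex.exp_nat_mul]
      congr 1
      simp only [hX]
      push_cast
      ring
    rw [this]
    push_cast
    ring)
  rw [← hfib.tsum_eq, tsum_mul_left, FbC, ← tsum_neg]
  congr 1
  refine tsum_congr fun k => ?_
  ring


lemma E_bound (ρ C₀ C₁ c : ℝ) (Dc : ℂ → ℂ) (hC0 : 0 < C₀) (hC1 : C₀ < 1) (hc : 0 < c)
    (K y₀ : ℝ) (hK : ∀ s : ℂ, -C₀ ≤ s.re → y₀ ≤ |s.im| → ‖Dc s‖ ≤ K * |s.im| ^ C₁) :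
    ∃ M T₀ : ℝ, 0 < M ∧ 1 ≤ T₀ ∧ ∀ s : ℂ, -C₀ ≤ s.re → s.re ≤ c → T₀ ≤ |s.im| →
      ‖Complex.Gamma s * riemannZeta (s + 1) * Dc s‖ ≤ M * Real.exp (-(7 * π / 24 * |s.im|)) := by
  obtain ⟨G, hG⟩ : ∃ G : ℝ, ∀ x ∈ Set.Icc (1 - C₀) (c + 1), ‖Real.Gamma x * 2 ^ x‖ ≤ G := by
    refine isCompact_Icc.exists_bound_of_continuousOn ?_
    intro x hx
    have hx0 : 0 < x := by linarith [hx.1]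
    have h1 : ContinuousAt Real.Gamma x := (Real.differentiableAt_Gamma (fun m => by
      have : (0 : ℝ) ≤ m := Nat.cast_nonneg m
      linarith)).continuousAt
    have h2 : ContinuousAt (fun x : ℝ => (2 : ℝ) ^ x) x :=
      (Real.continuous_const_rpow (by norm_num)).continuousAt
    exact (h1.mul h2).continuousWithinAt
  obtain ⟨C, hCpos, hC⟩ := zeta1_bound (1 - C₀) (by linarith)
  have hdec := tendsto_rpow_mul_exp_neg_mul_atTop_nhds_zero (2 + C₁) (π / 24) (by positivity)
  have hev := (hdec.eventually (gt_mem_nhds (show (0 : ℝ) < 1 by norm_num)))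
  obtain ⟨T₁, hT₁⟩ := eventually_atTop.1 hev
  have hG0 : 0 ≤ G := (norm_nonneg _).trans (hG (1 - C₀) ⟨le_rfl, by linarith⟩)
  set Z : ℝ := 1 + C * (c + 2) * (c + 3) with hZ
  have hZ0 : 0 < Z := by positivity
  refine ⟨G * Z * |K| + 1, max 1 (max y₀ T₁), by positivity, le_max_left _ _, ?_⟩
  intro s hs1 hs2 hs3
  set t := |s.im| with ht
  have ht1 : 1 ≤ t := (le_max_left _ _).trans hs3
  have hty : y₀ ≤ t := (le_max_left _ _).trans ((le_max_right _ _).trans hs3)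
  have htT : T₁ ≤ t := (le_max_right _ _).trans ((le_max_right _ _).trans hs3)
  have hst : t ≤ ‖s‖ := Complex.abs_im_le_norm s
  have hs0 : s ≠ 0 := by
    rintro rfl
    simp at hst
    linarith
  have hsn : 1 ≤ ‖s‖ := ht1.trans hst
  have hgam : ‖Complex.Gamma s‖ ≤ G * Real.exp (-(π / 3 * t)) := by
    have e : Complex.Gamma s = Complex.Gamma (s + 1) / s := by
      rw [Complex.Gamma_add_one s hs0]; field_simp
    rw [e, norm_div]
    refine (div_le_self (norm_nonneg _) hsn).trans ?_
    refine (gamma_bound (s + 1) (by simp; linarith)).trans ?_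
    have h1 : (s + 1).im = s.im := by simp
    have h2 : (s + 1).re = s.re + 1 := by simp
    rw [h1, h2]
    refine mul_le_mul_of_nonneg_right ?_ (Real.exp_pos _).le
    exact (le_abs_self _).trans (hG _ ⟨by linarith, by linarith⟩)
  have hzet : ‖riemannZeta (s + 1)‖ ≤ Z * t ^ 2 := by
    have e : riemannZeta (s + 1) = riemannZeta₁ (s + 1) / s := by
      rw [riemannZeta_eq_inv_sub_mul (by simpa using hs0)]
      simp; field_simp
    rw [e, norm_div]
    refine (div_le_self (norm_nonneg _) hsn).trans ?_
    refine (hC (s + 1) (by simp; linarith)).trans ?_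
    have hre : |s.re| ≤ c + 1 := abs_le.2 ⟨by linarith, by linarith⟩
    have hn : ‖s‖ ≤ (c + 2) * t := by
      refine (Complex.norm_le_abs_re_add_abs_im s).trans ?_
      nlinarith
    have hn1 : ‖s + 1‖ ≤ (c + 3) * t := by
      refine (norm_add_le _ _).trans ?_
      simp only [norm_one]
      nlinarith
    rw [add_sub_cancel_right]
    have : ‖s‖ * ‖s + 1‖ ≤ ((c + 2) * t) * ((c + 3) * t) := by gcongr
    have h2 : C * (‖s‖ * ‖s + 1‖) ≤ C * (((c + 2) * t) * ((c + 3) * t)) := by gcongr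
    rw [hZ]
    nlinarith
  have hDc : ‖Dc s‖ ≤ |K| * t ^ C₁ :=
    (hK s hs1 hty).trans (mul_le_mul_of_nonneg_right (le_abs_self K) (by positivity))
  have hlast : t ^ (2 + C₁) * Real.exp (-(π / 24) * t) ≤ 1 := (hT₁ t htT).le
  rw [norm_mul, norm_mul]
  calc ‖Complex.Gamma s‖ * ‖riemannZeta (s + 1)‖ * ‖Dc s‖
      ≤ (G * Real.exp (-(π / 3 * t))) * (Z * t ^ 2) * (|K| * t ^ C₁) := by gcongr
    _ = (G * Z * |K|) * (t ^ (2 + C₁) * Real.exp (-(π / 24) * t)) * Real.exp (-(7 * π / 24 * t)) := by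
        rw [Real.rpow_add (by linarith), Real.rpow_two]
        have : Real.exp (-(π / 3 * t)) = Real.exp (-(π / 24) * t) * Real.exp (-(7 * π / 24 * t)) := by
          rw [← Real.exp_add]; congr 1; ring
        rw [this]; ring
    _ ≤ (G * Z * |K|) * 1 * Real.exp (-(7 * π / 24 * t)) := by gcongr
    _ ≤ _ := by
        refine mul_le_mul_of_nonneg_right ?_ (Real.exp_pos _).le
        linarith

lemma E_diff (ρ C₀ : ℝ) (Dc : ℂ → ℂ) (hC1 : C₀ < 1)
    (hd : ∀ s : ℂ, -C₀ ≤ s.re → s ≠ (ρ : ℂ) → DifferentiableAt ℂ Dc s) (s : ℂ)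
    (h : -C₀ ≤ s.re) (h0 : s.re ≠ 0) (h1 : s.re ≠ ρ) :
    DifferentiableAt ℂ (fun s => Complex.Gamma s * riemannZeta (s + 1) * Dc s) s := by
  have hs0 : s ≠ 0 := by rintro rfl; simp at h0
  have hsρ : s ≠ (ρ : ℂ) := by rintro rfl; simp at h1
  have g1 : DifferentiableAt ℂ Complex.Gamma s := by
    refine Complex.differentiableAt_Gamma s fun m hm => ?_
    rcases Nat.eq_zero_or_pos m with rfl | hm'
    · simp at hm; exact hs0 hm
    · have h2 : (1 : ℝ) ≤ m := by exact_mod_cast hm'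
      rw [hm] at h
      simp at h
      linarith
  have g2 : DifferentiableAt ℂ (fun s => riemannZeta (s + 1)) s := by
    have := differentiableAt_riemannZeta (s := s + 1) (by simpa using hs0)
    exact this.comp s (by fun_prop)
  exact (g1.mul g2).mul (hd s h hsρ)

lemma E_line (ρ C₀ c : ℝ) (Dc : ℂ → ℂ) (hC1 : C₀ < 1)
    (hd : ∀ s : ℂ, -C₀ ≤ s.re → s ≠ (ρ : ℂ) → DifferentiableAt ℂ Dc s)
    (M T₀ : ℝ) (hM : 0 < M) (hT : ∀ s : ℂ, -C₀ ≤ s.re → s.re ≤ c → T₀ ≤ |s.im| →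
      ‖Complex.Gamma s * riemannZeta (s + 1) * Dc s‖ ≤ M * Real.exp (-(7 * π / 24 * |s.im|)))
    (a : ℝ) (ha : -C₀ ≤ a) (hac : a ≤ c) (ha0 : a ≠ 0) (haρ : a ≠ ρ) :
    Continuous (fun y : ℝ => Complex.Gamma (a + y * Complex.I) *
        riemannZeta (a + y * Complex.I + 1) * Dc (a + y * Complex.I)) ∧
    ∃ M' : ℝ, 0 < M' ∧ ∀ y : ℝ, ‖Complex.Gamma (a + y * Complex.I) *
        riemannZeta (a + y * Complex.I + 1) * Dc (a + y * Complex.I)‖ ≤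
          M' * Real.exp (-(7 * π / 24 * |y|)) := by
  have hcont : Continuous (fun y : ℝ => Complex.Gamma (a + y * Complex.I) *
        riemannZeta (a + y * Complex.I + 1) * Dc (a + y * Complex.I)) := by
    refine continuous_iff_continuousAt.2 fun y => ?_
    have h := (E_diff ρ C₀ Dc hC1 hd (a + y * Complex.I) (by simpa using ha) (by simpa using ha0)
      (by simpa using haρ)).continuousAt
    exact ContinuousAt.comp (f := fun y : ℝ => (a + y * Complex.I : ℂ)) h
      (Continuous.continuousAt (by fun_prop))
  refine ⟨hcont, ?_⟩
  obtain ⟨B, hB⟩ := (isCompact_Icc (a := -T₀) (b := T₀)).exists_bound_of_continuousOn hcont.continuousOn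
  refine ⟨M + |B| * Real.exp (7 * π / 24 * |T₀|), by positivity, fun y => ?_⟩
  rcases le_total T₀ |y| with h | h
  · have := hT (a + y * Complex.I) (by simpa using ha) (by simpa using hac) (by simpa using h)
    refine this.trans ?_
    simp only [Complex.add_im, Complex.ofReal_im, Complex.mul_im, Complex.ofReal_re, Complex.I_im,
      mul_one, Complex.I_re, mul_zero, add_zero, zero_add]
    refine mul_le_mul_of_nonneg_right ?_ (Real.exp_pos _).le
    have : 0 ≤ |B| * Real.exp (7 * π / 24 * |T₀|) := by positivity
    linarith
  · have h1 := (hB y (abs_le.1 h)).trans (le_abs_self B)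
    refine h1.trans ?_
    have h2 : (1 : ℝ) ≤ Real.exp (7 * π / 24 * |T₀|) * Real.exp (-(7 * π / 24 * |y|)) := by
      rw [← Real.exp_add]
      refine Real.one_le_exp ?_
      have : |y| ≤ |T₀| := h.trans (le_abs_self _)
      have hp : 0 < 7 * π / 24 := by positivity
      nlinarith
    have h3 : 0 ≤ M * Real.exp (-(7 * π / 24 * |y|)) := by positivity
    nlinarith [abs_nonneg B]

lemma tau_bound (τ : ℂ) (hτ : τ ≠ 0) (harg : |τ.arg| ≤ π / 4) (s : ℂ) :
    ‖τ ^ (-s)‖ ≤ ‖τ‖ ^ (-s.re) * Real.exp (π / 4 * |s.im|) := by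
  rw [norm_cpow_neg τ s hτ]
  refine mul_le_mul_of_nonneg_left (Real.exp_le_exp.2 ?_) (by positivity)
  refine (le_abs_self _).trans ?_
  rw [abs_mul]
  gcongr

lemma tau_norm (τ : ℂ) (harg : |τ.arg| ≤ π / 4) : ‖τ‖ ≤ 2 * τ.re := by
  have h := Complex.norm_mul_cos_arg τ
  have h1 : (1 / 2 : ℝ) ≤ Real.cos τ.arg := by
    rw [← Real.cos_abs, ← Real.cos_pi_div_three]
    exact Real.cos_le_cos_of_nonneg_of_le_pi (abs_nonneg _) (by linarith [Real.pi_pos])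
      (by linarith [Real.pi_pos])
  nlinarith [norm_nonneg τ]

lemma residue (N : ℂ → ℂ) (ρ C₀ A : ℝ) (Dc : ℂ → ℂ) (hρ : 0 < ρ) (hC0 : 0 < C₀)
    (hd : ∀ s : ℂ, -C₀ ≤ s.re → s ≠ (ρ : ℂ) → DifferentiableAt ℂ Dc s) (φ : ℂ → ℂ)
    (hφ : ∀ s : ℂ, -C₀ ≤ s.re → s ≠ (ρ : ℂ) → Dc s = (A : ℂ) / (s - (ρ : ℂ)) + φ s)
    (τ : ℂ) (hτ : τ ≠ 0)
    (hN : ∀ s, N s = Complex.Gamma (s + 1) * riemannZeta₁ (s + 1) * (A + (s - ρ) * φ s) * τ ^ (-s)) :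
    deriv (dslope N ρ) 0 = ((A * Real.Gamma ρ : ℝ) : ℂ) * riemannZeta ((ρ : ℂ) + 1) * τ ^ (-(ρ : ℂ))
            - Dc 0 * Complex.log τ + deriv Dc 0 := by
  have hρ0 : (ρ : ℂ) ≠ 0 := by exact_mod_cast hρ.ne'
  have hev : dslope N ρ =ᶠ[𝓝 0] fun s => Complex.Gamma (s + 1) * riemannZeta₁ (s + 1) * Dc s * τ ^ (-s)
      - N ρ / (s - ρ) := by
    have h1 : ∀ᶠ s : ℂ in 𝓝 0, s ≠ ρ := isOpen_ne.mem_nhds hρ0.symm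
    have h2 : ∀ᶠ s : ℂ in 𝓝 0, -C₀ < s.re :=
      (isOpen_lt continuous_const Complex.continuous_re).mem_nhds (by simpa using hC0)
    filter_upwards [h1, h2] with s hs1 hs2
    have hs : s - ρ ≠ 0 := sub_ne_zero.2 hs1
    rw [dslope_of_ne _ hs1, slope_def_field, hφ s hs2.le hs1, hN s]
    field_simp
  rw [hev.deriv_eq]
  have hs1 : HasDerivAt (fun s : ℂ => s + 1) 1 0 := (hasDerivAt_id (0 : ℂ)).add_const 1
  have dG : HasDerivAt (fun s : ℂ => Complex.Gamma (s + 1)) (-(Real.eulerMascheroniConstant : ℂ)) 0 := by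
    have h := Complex.hasDerivAt_Gamma_one
    have h' : HasDerivAt Complex.Gamma (-(Real.eulerMascheroniConstant : ℂ)) (0 + 1) := by
      rw [zero_add]; exact h
    exact (h'.comp (0 : ℂ) hs1).congr_deriv (by simp)
  have dZ : HasDerivAt (fun s : ℂ => riemannZeta₁ (s + 1)) (Real.eulerMascheroniConstant : ℂ) 0 := by
    have h := (differentiable_riemannZeta₁ (0 + 1)).hasDerivAt
    exact (h.comp (0 : ℂ) hs1).congr_deriv (by rw [zero_add, deriv_riemannZeta₁_one, mul_one])
  have dD : HasDerivAt Dc (deriv Dc 0) 0 := (hd 0 (by simpa using hC0.le) hρ0.symm).hasDerivAt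
  have dT : HasDerivAt (fun s : ℂ => τ ^ (-s)) (-Complex.log τ) 0 := by
    exact ((hasDerivAt_neg (0 : ℂ)).const_cpow (Or.inl hτ)).congr_deriv (by simp)
  have dR : HasDerivAt (fun s : ℂ => N ρ / (s - ρ)) (-(N ρ / ρ ^ 2)) 0 := by
    have h := ((hasDerivAt_const (0 : ℂ) (N ρ)).fun_div ((hasDerivAt_id (0 : ℂ)).sub_const (ρ : ℂ))
      (by simpa using hρ0))
    exact h.congr_deriv (by simp; ring)
  have hall := (((dG.fun_mul dZ).fun_mul dD).fun_mul dT).fun_sub dR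
  rw [hall.deriv]
  have hNρ : N ρ / ρ ^ 2 = ((A * Real.Gamma ρ : ℝ) : ℂ) * riemannZeta ((ρ : ℂ) + 1) * τ ^ (-(ρ : ℂ)) := by
    rw [hN ρ, Complex.Gamma_add_one _ hρ0, riemannZeta_eq_inv_sub_mul (by simpa using hρ0),
      Complex.ofReal_mul, ← Complex.Gamma_ofReal]
    simp
    field_simp
  rw [hNρ]
  simp [riemannZeta₁_one]
  ring

lemma exp_comb (y : ℝ) : Real.exp (-(7 * π / 24 * |y|)) * Real.exp (π / 4 * |y|) =
    Real.exp (-(π / 24 * |y|)) := by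
  rw [← Real.exp_add]; congr 1; ring

lemma line_int (E : ℝ → ℂ) (hE : Continuous E) (M : ℝ) (hM : 0 < M)
    (hb : ∀ y, ‖E y‖ ≤ M * Real.exp (-(7 * π / 24 * |y|))) (a : ℝ) (τ : ℂ) (hτ : τ ≠ 0)
    (harg : |τ.arg| ≤ π / 4) :
    Integrable (fun y : ℝ => E y * τ ^ (-(a + y * Complex.I))) ∧
    ‖∫ y : ℝ, E y * τ ^ (-(a + y * Complex.I))‖ ≤
      ‖τ‖ ^ (-a) * (M * ∫ y : ℝ, Real.exp (-(π / 24 * |y|))) := by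
  have hbd : ∀ y : ℝ, ‖E y * τ ^ (-(a + y * Complex.I))‖ ≤
      (‖τ‖ ^ (-a) * M) * Real.exp (-(π / 24 * |y|)) := by
    intro y
    have h := tau_bound τ hτ harg (a + y * Complex.I)
    simp only [Complex.add_im, Complex.ofReal_im, Complex.mul_im, Complex.ofReal_re, Complex.I_im,
      mul_one, Complex.I_re, mul_zero, add_zero, zero_add, Complex.add_re, Complex.mul_re,
      sub_zero] at h
    rw [norm_mul, ← exp_comb]
    calc _ ≤ (M * Real.exp (-(7 * π / 24 * |y|))) * (‖τ‖ ^ (-a) * Real.exp (π / 4 * |y|)) := by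
          gcongr
          exact hb y
      _ = _ := by ring
  have hi := (integrable_exp_neg_abs (π / 24) (by positivity)).const_mul (‖τ‖ ^ (-a) * M)
  have hc : Continuous (fun y : ℝ => E y * τ ^ (-(a + y * Complex.I))) :=
    hE.mul (Continuous.const_cpow (by fun_prop) (Or.inl hτ))
  refine ⟨hi.mono' hc.aestronglyMeasurable (Eventually.of_forall hbd), ?_⟩
  refine (norm_integral_le_of_norm_le hi (Eventually.of_forall hbd)).trans ?_
  rw [integral_const_mul, mul_assoc]

lemma main_aux    (b : ℕ → ℝ) (hb : ∀ k, 0 ≤ b k) (ρ C₀ A C₁ : ℝ) (Dc : ℂ → ℂ)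
    (hρ : 0 < ρ) (hC0 : 0 < C₀) (hC1 : C₀ < 1)
    (hD : ∀ s : ℂ, ρ < s.re →
      HasSum (fun k : ℕ => (b (k + 1) : ℂ) * ((k + 1 : ℕ) : ℂ) ^ (-s)) (Dc s))
    (hd : ∀ s : ℂ, -C₀ ≤ s.re → s ≠ (ρ : ℂ) → DifferentiableAt ℂ Dc s)
    (φ : ℂ → ℂ) (hφd : ∀ s : ℂ, -C₀ ≤ s.re → DifferentiableAt ℂ φ s)
    (hφ : ∀ s : ℂ, -C₀ ≤ s.re → s ≠ (ρ : ℂ) → Dc s = (A : ℂ) / (s - (ρ : ℂ)) + φ s)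
    (K y₀ : ℝ) (hK : ∀ s : ℂ, -C₀ ≤ s.re → y₀ ≤ |s.im| → ‖Dc s‖ ≤ K * |s.im| ^ C₁) :
    ∃ K α₀ : ℝ, 0 < K ∧ 0 < α₀ ∧ ∀ τ : ℂ, 0 < τ.re → τ.re ≤ α₀ → |τ.im| ≤ π →
      |Complex.arg τ| ≤ π / 4 →
      ‖FbC b (Complex.exp (-τ)) -
          (((A * Real.Gamma ρ : ℝ) : ℂ) * riemannZeta ((ρ : ℂ) + 1) * τ ^ (-(ρ : ℂ))
            - Dc 0 * Complex.log τ + deriv Dc 0)‖ ≤ K * τ.re ^ C₀ := by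
  obtain ⟨c, hc⟩ : ∃ c, ρ < c := ⟨ρ + 1, by linarith⟩
  have hc0 : 0 < c := hρ.trans hc
  obtain ⟨M, T₀, hM, hT1, hT⟩ := E_bound ρ C₀ C₁ c Dc hC0 hC1 hc0 K y₀ hK
  obtain ⟨hEc, M1, hM1, hE1⟩ := E_line ρ C₀ c Dc hC1 hd M T₀ hM hT c (by linarith) le_rfl hc0.ne' hc.ne'
  obtain ⟨hEc', M2, hM2, hE2⟩ := E_line ρ C₀ c Dc hC1 hd M T₀ hM hT (-C₀) le_rfl (by linarith)
    (by linarith) (by linarith)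
  set J : ℝ := ∫ y : ℝ, Real.exp (-(π / 24 * |y|)) with hJ
  have hJ0 : 0 ≤ J := integral_nonneg fun y => (Real.exp_pos _).le
  refine ⟨2 ^ C₀ * (M2 * J) + 1, 1, by positivity, one_pos, ?_⟩
  intro τ hτ _ _ harg
  have hτ0 : τ ≠ 0 := by rintro rfl; simp at hτ
  have hτn : 0 < ‖τ‖ := norm_pos_iff.2 hτ0
  obtain ⟨hI1, -⟩ := line_int _ hEc M1 hM1 hE1 c τ hτ0 harg
  obtain ⟨hI2, hI2b⟩ := line_int _ hEc' M2 hM2 hE2 (-C₀) τ hτ0 harg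
  obtain ⟨N, hN⟩ : ∃ N : ℂ → ℂ, ∀ s, N s = Complex.Gamma (s + 1) * riemannZeta₁ (s + 1) *
    (A + (s - ρ) * φ s) * τ ^ (-s) := ⟨_, fun s => rfl⟩
  have hNd : ∀ s : ℂ, -C₀ ≤ s.re → DifferentiableAt ℂ N s := by
    intro s hs
    rw [show N = _ from funext hN]
    have g1 : DifferentiableAt ℂ (fun s => Complex.Gamma (s + 1)) s := by
      have h := Complex.differentiableAt_Gamma (s + 1) (fun m hm => by
        have := congrArg Complex.re hm
        simp at this
        have h0 : (0 : ℝ) ≤ m := Nat.cast_nonneg m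
        linarith)
      exact h.comp s (by fun_prop)
    have g2 : DifferentiableAt ℂ (fun s => riemannZeta₁ (s + 1)) s :=
      DifferentiableAt.comp (g := riemannZeta₁) (f := fun s => s + 1) s
        (differentiable_riemannZeta₁ (s + 1)) (by fun_prop)
    have g3 : DifferentiableAt ℂ (fun s => (A : ℂ) + (s - ρ) * φ s) s :=
      (DifferentiableAt.mul (by fun_prop) (hφd s hs)).const_add _
    have g4 : DifferentiableAt ℂ (fun s => τ ^ (-s)) s :=
      DifferentiableAt.const_cpow (by fun_prop) (Or.inl hτ0)
    exact ((g1.mul g2).mul g3).mul g4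
  have hNE : ∀ s : ℂ, -C₀ ≤ s.re → s ≠ 0 → s ≠ ρ → N s / (s ^ 2 * (s - ρ)) =
      Complex.Gamma s * riemannZeta (s + 1) * Dc s * τ ^ (-s) := by
    intro s hs hs0 hsρ
    have hs' : s - ρ ≠ 0 := sub_ne_zero.2 hsρ
    rw [hN, Complex.Gamma_add_one _ hs0, riemannZeta_eq_inv_sub_mul (by simpa using hs0),
      hφ s hs hsρ, add_sub_cancel_right]
    field_simp
  have hline : ∀ a : ℝ, -C₀ ≤ a → a ≠ 0 → a ≠ ρ → ∀ y : ℝ,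
      N (a + y * Complex.I) / ((a + y * Complex.I) ^ 2 * (a + y * Complex.I - ρ)) =
      Complex.Gamma (a + y * Complex.I) * riemannZeta (a + y * Complex.I + 1) *
        Dc (a + y * Complex.I) * τ ^ (-(a + y * Complex.I)) := by
    intro a h1 h2 h3 y
    refine hNE _ (by simpa using h1) (fun h => h2 ?_) (fun h => h3 ?_)
    · simpa using congrArg Complex.re h
    · simpa using congrArg Complex.re h
  obtain ⟨B, hB⟩ : ∃ B : ℝ, ∀ x ∈ Set.Icc (-C₀) c, ‖‖τ‖ ^ (-x)‖ ≤ B := by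
    refine isCompact_Icc.exists_bound_of_continuousOn (Continuous.continuousOn ?_)
    exact (Real.continuous_const_rpow hτn.ne').comp continuous_neg
  have hg : Tendsto (fun T : ℝ => M * B * Real.exp (-(π / 24 * T))) atTop (𝓝 0) := by
    have h1 : Tendsto (fun T : ℝ => π / 24 * T) atTop atTop :=
      tendsto_id.const_mul_atTop (by positivity)
    have := (Real.tendsto_exp_neg_atTop_nhds_zero.comp h1).const_mul (M * B)
    simpa using this
  have hct := contour N ρ C₀ c hC0 hρ hc hNd _ hg T₀ (by
      intro s h1 h2 h3
      have him : s.im ≠ 0 := by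
        intro h; rw [h] at h3; simp at h3; linarith
      rw [hNE s h1 (by rintro rfl; simp at him) (by rintro rfl; simp at him), norm_mul,
        ← abs_abs s.im, ← exp_comb, abs_abs]
      have e1 := hT s h1 h2 h3
      have e2 := tau_bound τ hτ0 harg s
      have e3 : ‖τ‖ ^ (-s.re) ≤ B := (le_abs_self _).trans (hB s.re ⟨h1, h2⟩)
      calc _ ≤ (M * Real.exp (-(7 * π / 24 * |s.im|))) * (B * Real.exp (π / 4 * |s.im|)) := by
            gcongr
            refine e2.trans ?_
            gcongr
        _ = _ := by ring)
    (hI1.congr (Eventually.of_forall fun y => (hline c (by linarith) hc0.ne' hc.ne' y).symm))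
    (hI2.congr (Eventually.of_forall fun y => (hline (-C₀) le_rfl (by linarith) (by linarith) y).symm))
  simp only [hline c (by linarith) hc0.ne' hc.ne',
    hline (-C₀) le_rfl (by linarith) (by linarith)] at hct
  rw [← FbC_int b hb c hc0 Dc (fun s hs => hD s (by rw [hs]; exact hc)) τ hτ harg,
    residue N ρ C₀ A Dc hρ hC0 hd φ hφ τ hτ0 hN] at hct
  set R : ℂ := ((A * Real.Gamma ρ : ℝ) : ℂ) * riemannZeta ((ρ : ℂ) + 1) * τ ^ (-(ρ : ℂ))
            - Dc 0 * Complex.log τ + deriv Dc 0 with hR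
  set Q : ℂ := ∫ y : ℝ, Complex.Gamma ((-C₀ : ℝ) + y * Complex.I) *
    riemannZeta ((-C₀ : ℝ) + y * Complex.I + 1) *
        Dc ((-C₀ : ℝ) + y * Complex.I) * τ ^ (-(((-C₀ : ℝ) : ℂ) + y * Complex.I)) with hQ
  have hfin : (2 * π : ℂ) * (FbC b (Complex.exp (-τ)) - R) = Q := by
    linear_combination hct
  have hn := congrArg norm hfin
  rw [norm_mul] at hn
  have h2π : ‖(2 * π : ℂ)‖ = 2 * π := by
    rw [norm_mul, Complex.norm_real, Real.norm_of_nonneg Real.pi_pos.le]; simp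
  rw [h2π] at hn
  have h1 : ‖FbC b (Complex.exp (-τ)) - R‖ ≤ ‖Q‖ := by
    rw [← hn]
    refine le_mul_of_one_le_left (norm_nonneg _) ?_
    linarith [Real.pi_gt_three]
  refine (h1.trans hI2b).trans ?_
  rw [neg_neg]
  have h3 : ‖τ‖ ^ C₀ ≤ 2 ^ C₀ * τ.re ^ C₀ := by
    rw [← Real.mul_rpow (by norm_num) hτ.le]
    exact Real.rpow_le_rpow hτn.le (tau_norm τ harg) hC0.le
  have h4 : 0 ≤ τ.re ^ C₀ := by positivity
  calc ‖τ‖ ^ C₀ * (M2 * J) ≤ (2 ^ C₀ * τ.re ^ C₀) * (M2 * J) := by gcongr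
    _ ≤ _ := by nlinarith

theorem statement1    (b : ℕ → ℝ) (hb : ∀ k, 0 ≤ b k) (ρ C₀ A C₁ : ℝ) (Dc : ℂ → ℂ)
    (h1 : M1 b ρ C₀ A Dc) (h2 : M2 C₀ C₁ Dc) :
    ∃ K α₀ : ℝ, 0 < K ∧ 0 < α₀ ∧ ∀ τ : ℂ, 0 < τ.re → τ.re ≤ α₀ → |τ.im| ≤ π →
      |Complex.arg τ| ≤ π / 4 →
      ‖FbC b (Complex.exp (-τ)) -
          (((A * Real.Gamma ρ : ℝ) : ℂ) * riemannZeta ((ρ : ℂ) + 1) * τ ^ (-(ρ : ℂ))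
            - Dc 0 * Complex.log τ + deriv Dc 0)‖ ≤ K * τ.re ^ C₀ := by
  obtain ⟨hρ, hC0, hC1, _, hD, hd, φ, hφd, hφ⟩ := h1
  obtain ⟨_, K, y₀, hK⟩ := h2
  exact main_aux b hb ρ C₀ A C₁ Dc hρ hC0 hC1 hD hd φ hφd hφ K y₀ hK
end
end

section
/- Assume the weight sequence b satisfies conditions (M1) and (M2). Then, as α → 0⁺, 𝒜_b(e^{−α}) = h α^{−ρ−1} + D(0) α^{−1} + D′(0) + O(α^{C₀−1}), where h = A Γ(ρ+1) ζ(ρ+1) and D(0), D′(0) are the value and derivative at s = 0 of the analytic continuation of D. -/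
open Filter Topology Asymptotics MeasureTheory Real

noncomputable section

lemma norm_Gamma_le_aux (s : ℂ) (hs : 0 < s.re) : ‖Complex.Gamma s‖ ≤ Real.Gamma s.re := by
  rw [Complex.Gamma_eq_integral hs, Real.Gamma_eq_integral hs, Complex.GammaIntegral]
  refine (norm_integral_le_integral_norm _).trans (le_of_eq ?_)
  refine setIntegral_congr_fun measurableSet_Ioi fun t ht => ?_
  have ht' : (0:ℝ) < t := ht
  simp only [norm_mul, Complex.norm_real]
  rw [Complex.norm_cpow_eq_rpow_re_of_pos ht']
  simp [abs_of_pos (Real.exp_pos _)]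

lemma gamma_bound_s2 (N : ℕ) : ∀ (σ₁ σ₂ : ℝ), 0 < σ₁ → ∃ K : ℝ, 0 ≤ K ∧ ∀ s : ℂ, σ₁ ≤ s.re →
    s.re ≤ σ₂ → ‖Complex.Gamma s‖ * (1 + |s.im|) ^ N ≤ K := by
  induction N with
  | zero =>
    intro σ₁ σ₂ h
    have hc : ContinuousOn Real.Gamma (Set.Icc σ₁ σ₂) := fun x hx =>
      (Real.differentiableAt_Gamma (fun m => by
        have : (0:ℝ) ≤ m := m.cast_nonneg
        have := hx.1
        intro h; linarith)).continuousAt.continuousWithinAt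
    obtain ⟨K, hK⟩ := isCompact_Icc.exists_bound_of_continuousOn hc
    refine ⟨max K 0, le_max_right _ _, fun s h1 h2 => ?_⟩
    rw [pow_zero, mul_one]
    exact (norm_Gamma_le_aux s (by linarith)).trans ((le_abs_self _).trans ((hK _ ⟨h1, h2⟩).trans (le_max_left _ _)))
  | succ N ih =>
    intro σ₁ σ₂ h
    obtain ⟨K, hK0, hK⟩ := ih (σ₁ + 1) (σ₂ + 1) (by linarith)
    refine ⟨K * (1 / σ₁ + 1), by positivity, fun s h1 h2 => ?_⟩
    have hre : 0 < s.re := by linarith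
    have hs0 : s ≠ 0 := by rintro rfl; simp at hre
    have hg := Complex.Gamma_add_one s hs0
    have := hK (s + 1) (by simpa using h1) (by simpa using h2)
    rw [hg, norm_mul] at this
    have e : (s + 1).im = s.im := by simp
    rw [e] at this
    have h3 : 1 + |s.im| ≤ (1 / σ₁ + 1) * ‖s‖ := by
      have := Complex.abs_im_le_norm s
      have h4 : σ₁ ≤ ‖s‖ := h1.trans ((le_abs_self _).trans (Complex.abs_re_le_norm s))
      have h5 : 1 ≤ 1 / σ₁ * ‖s‖ := by
        rw [one_div_mul_eq_div, le_div_iff₀ h]; linarith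
      linarith
    calc ‖Complex.Gamma s‖ * (1 + |s.im|) ^ (N + 1)
        = ‖Complex.Gamma s‖ * (1 + |s.im|) ^ N * (1 + |s.im|) := by ring
      _ ≤ ‖Complex.Gamma s‖ * (1 + |s.im|) ^ N * ((1 / σ₁ + 1) * ‖s‖) := by gcongr
      _ = ‖s‖ * ‖Complex.Gamma s‖ * (1 + |s.im|) ^ N * (1 / σ₁ + 1) := by ring
      _ ≤ _ := by gcongr


def Jz (s : ℂ) : ℂ := ∫ t in Set.Ioi (1:ℝ), ((Int.fract t : ℝ) : ℂ) * (t:ℂ) ^ (-(s + 1))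

lemma Jz_eq_mellin (s : ℂ) :
    Jz s = mellin (Set.indicator (Set.Ioi (1:ℝ)) (fun t => ((Int.fract t : ℝ) : ℂ))) (-s) := by
  unfold Jz mellin
  have h : ∀ t : ℝ, (t:ℂ) ^ (-s - 1) • Set.indicator (Set.Ioi (1:ℝ)) (fun t => ((Int.fract t : ℝ) : ℂ)) t
      = Set.indicator (Set.Ioi (1:ℝ)) (fun t => ((Int.fract t : ℝ) : ℂ) * (t:ℂ) ^ (-(s + 1))) t := by
    intro t
    by_cases ht : t ∈ Set.Ioi (1:ℝ)
    · rw [Set.indicator_of_mem ht, Set.indicator_of_mem ht, smul_eq_mul, mul_comm, neg_add']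
    · rw [Set.indicator_of_notMem ht, Set.indicator_of_notMem ht, smul_zero]
  simp_rw [h]
  rw [setIntegral_indicator measurableSet_Ioi,
    Set.inter_eq_self_of_subset_right (Set.Ioi_subset_Ioi zero_le_one)]

lemma Jz_diff (s : ℂ) (hs : 0 < s.re) : DifferentiableAt ℂ Jz s := by
  have : Jz = fun s => mellin (Set.indicator (Set.Ioi (1:ℝ)) (fun t => ((Int.fract t : ℝ) : ℂ))) (-s) :=
    funext Jz_eq_mellin
  rw [this]
  have key : DifferentiableAt ℂ
      (mellin (Set.indicator (Set.Ioi (1:ℝ)) (fun t => ((Int.fract t : ℝ) : ℂ)))) (-s) := by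
    have hb : ∀ t : ℝ, ‖Set.indicator (Set.Ioi (1:ℝ)) (fun t => ((Int.fract t : ℝ) : ℂ)) t‖ ≤ 1 := by
      intro t
      refine (norm_indicator_le_norm_self _ _).trans ?_
      rw [Complex.norm_real, Real.norm_eq_abs, abs_of_nonneg (Int.fract_nonneg t)]
      exact (Int.fract_lt_one t).le
    apply mellin_differentiableAt_of_isBigO_rpow (a := 0) (b := -s.re - 1)
    · apply LocallyIntegrable.locallyIntegrableOn
      apply (locallyIntegrable_const (1:ℝ)).mono
      · apply Measurable.aestronglyMeasurable
        apply Measurable.indicator _ measurableSet_Ioi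
        exact Complex.measurable_ofReal.comp measurable_fract
      · filter_upwards with t
        simpa using hb t
    · apply IsBigO.of_bound 1
      filter_upwards with t
      simpa using hb t
    · simpa using hs
    · have : (Set.indicator (Set.Ioi (1:ℝ)) (fun t => ((Int.fract t : ℝ) : ℂ))) =ᶠ[𝓝[>] 0] fun _ => 0 := by
        filter_upwards [Ioo_mem_nhdsGT (zero_lt_one (α := ℝ))] with t ht
        apply Set.indicator_of_notMem
        simpa using ht.2.le
      exact this.trans_isBigO (isBigO_zero _ _)
    · simp
  exact key.comp s differentiableAt_id.neg

lemma Jz_int (s : ℂ) (hs : 0 < s.re) :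
    IntegrableOn (fun t : ℝ => ((Int.fract t : ℝ) : ℂ) * (t:ℂ) ^ (-(s + 1))) (Set.Ioi 1) := by
  have h1 := integrableOn_Ioi_cpow_of_lt (a := -(s+1)) (c := 1) (by simp; linarith) one_pos
  refine h1.bdd_mul (c := 1) (Complex.measurable_ofReal.comp measurable_fract).aestronglyMeasurable ?_
  filter_upwards with t
  rw [Complex.norm_real, Real.norm_eq_abs, abs_of_nonneg (Int.fract_nonneg t)]
  exact (Int.fract_lt_one t).le

lemma Jz_bound (s : ℂ) (hs : 0 < s.re) : ‖Jz s‖ ≤ 1 / s.re := by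
  unfold Jz
  have : ∫ t in Set.Ioi (1:ℝ), t ^ (-(s.re + 1)) = 1 / s.re := by
    rw [integral_Ioi_rpow_of_lt (by linarith) one_pos]
    have : -(s.re + 1) + 1 = - s.re := by ring
    rw [this]; simp
  rw [← this]
  apply norm_integral_le_of_norm_le
  · exact integrableOn_Ioi_rpow_of_lt (by linarith) one_pos
  · filter_upwards [ae_restrict_mem measurableSet_Ioi] with t ht
    have ht' : 0 < t := one_pos.trans ht
    rw [norm_mul, Complex.norm_cpow_eq_rpow_re_of_pos ht', Complex.norm_real, Real.norm_eq_abs,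
      abs_of_nonneg (Int.fract_nonneg t)]
    have e : (-(s+1)).re = -(s.re + 1) := by simp
    rw [e]
    have := (Int.fract_lt_one t).le
    have h2 : 0 ≤ t ^ (-(s.re+1)) := by positivity
    nlinarith

lemma zeta_eq_Jz (s : ℂ) (hs : 1 < s.re) : riemannZeta₁ s = s - s * (s - 1) * Jz s := by
  have hs1 : s ≠ 1 := by rintro rfl; simp at hs
  have hs1' : s - 1 ≠ 0 := sub_ne_zero.mpr hs1
  have h0 : riemannZeta₁ s = (s - 1) * riemannZeta s := by
    rw [riemannZeta_eq_inv_sub_mul hs1]; field_simp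
  have h1 := LSeries_eq_mul_integral' (fun _ => (1:ℂ)) zero_le_one hs (by
    apply IsBigO.of_bound 1
    filter_upwards with n
    simp)
  have h2 : LSeries (fun _ => (1:ℂ)) s = riemannZeta s := LSeries_one_eq_riemannZeta hs
  have h3 : ∫ t in Set.Ioi (1 : ℝ), (∑ k ∈ Finset.Icc 1 ⌊t⌋₊, (1:ℂ)) * (t:ℂ) ^ (-(s + 1))
      = 1 / (s - 1) - Jz s := by
    have h4 : ∫ t in Set.Ioi (1:ℝ), (t:ℂ) ^ (-s) = 1 / (s - 1) := by
      rw [integral_Ioi_cpow_of_lt (by simpa using hs) one_pos]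
      have : -s + 1 ≠ 0 := by intro h; apply hs1'; linear_combination -h
      simp
      field_simp
      ring
    rw [← h4, Jz, ← integral_sub (integrableOn_Ioi_cpow_of_lt (by simpa using hs) one_pos)
      (Jz_int s (by linarith))]
    refine setIntegral_congr_fun measurableSet_Ioi fun t ht => ?_
    have ht' : (0:ℝ) < t := one_pos.trans ht
    have e1 : (t:ℂ) ^ (-s) = t * (t:ℂ) ^ (-(s+1)) := by
      have : -s = 1 + -(s+1) := by ring
      rw [this, Complex.cpow_add _ _ (by exact_mod_cast ht'.ne'), Complex.cpow_one]
    have e2 : ((⌊t⌋₊ : ℕ) : ℂ) = t - ((Int.fract t : ℝ) : ℂ) := by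
      have : ((⌊t⌋₊ : ℕ) : ℝ) = t - Int.fract t := by
        rw [natCast_floor_eq_intCast_floor ht'.le]; simp [Int.self_sub_fract]
      exact_mod_cast congrArg (fun x : ℝ => (x:ℂ)) this
    simp only [Finset.sum_const, Nat.card_Icc, nsmul_eq_mul, mul_one, add_tsub_cancel_right]
    rw [e1, e2]; ring
  rw [h3] at h1
  rw [h0, ← h2, h1]
  field_simp

lemma zeta_eq_Jz' (s : ℂ) (hs : 0 < s.re) : riemannZeta₁ s = s - s * (s - 1) * Jz s := by
  have hopen : IsOpen {s : ℂ | 0 < s.re} := isOpen_lt continuous_const Complex.continuous_re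
  have hpre : IsPreconnected {s : ℂ | 0 < s.re} := (convex_halfSpace_re_gt 0).isPreconnected
  have hf : AnalyticOnNhd ℂ riemannZeta₁ {s : ℂ | 0 < s.re} :=
    differentiable_riemannZeta₁.differentiableOn.analyticOnNhd hopen
  have hg : AnalyticOnNhd ℂ (fun s => s - s * (s - 1) * Jz s) {s : ℂ | 0 < s.re} := by
    apply DifferentiableOn.analyticOnNhd _ hopen
    intro z hz
    have := Jz_diff z hz
    apply DifferentiableAt.differentiableWithinAt
    fun_prop
  refine hf.eqOn_of_preconnected_of_eventuallyEq hg hpre (z₀ := 2) (by simp) ?_ hs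
  have : {s : ℂ | 1 < s.re} ∈ 𝓝 (2:ℂ) :=
    (isOpen_lt continuous_const Complex.continuous_re).mem_nhds (by simp)
  filter_upwards [this] with z hz using zeta_eq_Jz z hz

lemma zeta_bound (σ₁ σ₂ : ℝ) (h : 0 < σ₁) : ∃ K : ℝ, 0 ≤ K ∧ ∀ s : ℂ, σ₁ ≤ s.re →
    s.re ≤ σ₂ → ‖riemannZeta₁ s‖ ≤ K * (1 + |s.im|) ^ 2 := by
  refine ⟨(|σ₂| + 1) + (|σ₂| + 1) * (|σ₂| + 2) * (1 / σ₁), by positivity, fun s h1 h2 => ?_⟩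
  rw [zeta_eq_Jz' s (by linarith)]
  have hJ : ‖Jz s‖ ≤ 1 / σ₁ := (Jz_bound s (by linarith)).trans (by gcongr)
  have hn : ‖s‖ ≤ (|σ₂| + 1) * (1 + |s.im|) := by
    have h3 := Complex.norm_le_abs_re_add_abs_im s
    have h4 : |s.re| ≤ |σ₂| := by
      rw [abs_of_nonneg (by linarith : 0 ≤ s.re)]; exact h2.trans (le_abs_self _)
    nlinarith [abs_nonneg s.im, abs_nonneg σ₂]
  have hn1 : ‖s - 1‖ ≤ (|σ₂| + 2) * (1 + |s.im|) := by
    have := norm_sub_le s 1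
    rw [norm_one] at this
    nlinarith [abs_nonneg s.im, abs_nonneg σ₂]
  calc ‖s - s * (s - 1) * Jz s‖ ≤ ‖s‖ + ‖s‖ * ‖s - 1‖ * ‖Jz s‖ := by
        refine (norm_sub_le _ _).trans ?_
        rw [norm_mul, norm_mul]
    _ ≤ (|σ₂| + 1) * (1 + |s.im|) ^ 2
        + ((|σ₂| + 1) * (1 + |s.im|)) * ((|σ₂| + 2) * (1 + |s.im|)) * (1 / σ₁) := by
        gcongr
        refine hn.trans ?_
        gcongr
        nlinarith [abs_nonneg s.im]
    _ = _ := by ring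


lemma line_ne (x t : ℝ) (hx : x ≠ 0) : (x:ℂ) + t * Complex.I ≠ 0 := by
  intro h
  apply hx
  simpa using congrArg Complex.re h

lemma inv_cont (x : ℝ) (hx : x ≠ 0) : Continuous fun t : ℝ => ((x:ℂ) + t * Complex.I)⁻¹ :=
  Continuous.inv₀ (by fun_prop) (fun t => line_ne x t hx)

lemma inv_line (x : ℝ) (hx : 0 < x) :
    Tendsto (fun T : ℝ => ∫ t in (-T)..T, ((x:ℂ) + t * Complex.I)⁻¹) atTop (𝓝 (π:ℂ)) := by
  have key : ∀ T : ℝ, ∫ t in (-T)..T, ((x:ℂ) + t * Complex.I)⁻¹ = ((2 * Real.arctan (T / x) : ℝ) : ℂ) := by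
    intro T
    have hc := inv_cont x hx.ne'
    have h1 : ∫ t in (-T)..T, ((x:ℂ) + (-t : ℝ) * Complex.I)⁻¹
        = ∫ t in (-T)..T, ((x:ℂ) + t * Complex.I)⁻¹ := by
      rw [intervalIntegral.integral_comp_neg (fun t : ℝ => ((x:ℂ) + t * Complex.I)⁻¹), neg_neg]
    have h2 : ∫ t in (-T)..T, (((x:ℂ) + t * Complex.I)⁻¹ + ((x:ℂ) + (-t : ℝ) * Complex.I)⁻¹)
        = 2 * ∫ t in (-T)..T, ((x:ℂ) + t * Complex.I)⁻¹ := by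
      have hc2 : Continuous fun t : ℝ => ((x:ℂ) + (-t : ℝ) * Complex.I)⁻¹ :=
        hc.comp continuous_neg
      rw [intervalIntegral.integral_add (hc.intervalIntegrable _ _)
        (hc2.intervalIntegrable _ _), h1]
      ring
    have h3 : ∀ t : ℝ, ((x:ℂ) + t * Complex.I)⁻¹ + ((x:ℂ) + (-t : ℝ) * Complex.I)⁻¹
        = ((2 * (1 / (1 + (t / x) ^ 2) * (1 / x)) : ℝ) : ℂ) := by
      intro t
      have e1 := line_ne x t hx.ne'
      have e2 := line_ne x (-t) hx.ne'
      have e3 : (x:ℂ) ≠ 0 := by exact_mod_cast hx.ne'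
      have e4 : ((x:ℂ) ^ 2 + (t:ℂ) ^ 2) ≠ 0 := by
        have : x ^ 2 + t ^ 2 ≠ 0 := by positivity
        exact_mod_cast this
      have e5 : (1 + ((t:ℂ) / x) ^ 2) ≠ 0 := by
        have : 1 + (t / x) ^ 2 ≠ 0 := by positivity
        exact_mod_cast this
      have e6 : ((x:ℂ) + t * Complex.I) * ((x:ℂ) + (-t : ℝ) * Complex.I) = x ^ 2 + t ^ 2 := by
        push_cast
        linear_combination -(t:ℂ) ^ 2 * Complex.I_sq
      rw [inv_add_inv e1 e2, e6]
      push_cast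
      field_simp
      ring
    have h4 : ∫ t in (-T)..T, (2 * (1 / (1 + (t / x) ^ 2) * (1 / x)) : ℝ)
        = 2 * (2 * Real.arctan (T / x)) := by
      rw [intervalIntegral.integral_eq_sub_of_hasDerivAt
        (f := fun t => 2 * Real.arctan (t / x))]
      · rw [neg_div, Real.arctan_neg]; ring
      · intro t _
        exact (((hasDerivAt_id t).div_const x).arctan).const_mul 2
      · apply Continuous.intervalIntegrable
        have : ∀ t : ℝ, 1 + (t / x) ^ 2 ≠ 0 := fun t => by positivity
        fun_prop (disch := assumption)
    have h5 : (2:ℂ) * ∫ t in (-T)..T, ((x:ℂ) + t * Complex.I)⁻¹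
        = 2 * ((2 * Real.arctan (T / x) : ℝ) : ℂ) := by
      rw [← h2]
      simp_rw [h3]
      rw [intervalIntegral.integral_ofReal, h4]
      push_cast; ring
    exact mul_left_cancel₀ two_ne_zero h5
  simp_rw [key]
  have : Tendsto (fun T : ℝ => 2 * Real.arctan (T / x)) atTop (𝓝 (2 * (π / 2))) := by
    refine Tendsto.const_mul 2 ?_
    exact (tendsto_nhds_of_tendsto_nhdsWithin Real.tendsto_arctan_atTop).comp
      (tendsto_id.atTop_div_const hx)
  rw [mul_div_cancel₀ _ two_ne_zero] at this
  exact (Complex.continuous_ofReal.tendsto _).comp this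

lemma inv_line_neg (x : ℝ) (hx : x < 0) :
    Tendsto (fun T : ℝ => ∫ t in (-T)..T, ((x:ℂ) + t * Complex.I)⁻¹) atTop (𝓝 (-π:ℂ)) := by
  have h := (inv_line (-x) (by linarith)).neg
  refine h.congr fun T => ?_
  rw [← intervalIntegral.integral_neg,
    ← neg_neg T, ← intervalIntegral.integral_comp_neg, neg_neg]
  congr 1
  ext t
  push_cast
  rw [← inv_neg]
  congr 1
  ring

lemma line_integrable (U : ℂ → ℂ) (σ₁ σ₂ σ a K : ℝ) (h1 : σ₁ ≤ σ) (h2 : σ ≤ σ₂) (ha : σ ≠ a)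
    (hU : DifferentiableOn ℂ U {s | σ₁ ≤ s.re ∧ s.re ≤ σ₂})
    (hK : ∀ s : ℂ, σ₁ ≤ s.re → s.re ≤ σ₂ → ‖U s‖ ≤ K / (1 + s.im ^ 2)) :
    Integrable fun t : ℝ => U (σ + t * Complex.I) * (((σ - a : ℝ):ℂ) + t * Complex.I)⁻¹ := by
  have hsa : σ - a ≠ 0 := sub_ne_zero.mpr ha
  have hi : Integrable fun t : ℝ => K * (1 + t ^ 2)⁻¹ * |σ - a|⁻¹ :=
    (integrable_inv_one_add_sq.const_mul K).mul_const _
  have hc : Continuous fun t : ℝ => U (σ + t * Complex.I) :=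
    hU.continuousOn.comp_continuous (by fun_prop) (fun t => by simp [h1, h2])
  refine hi.mono' (hc.mul (inv_cont _ hsa)).aestronglyMeasurable ?_
  filter_upwards with t
  rw [norm_mul, norm_inv]
  have e1 := hK (σ + t * Complex.I) (by simpa using h1) (by simpa using h2)
  have e2 : ((σ:ℂ) + t * Complex.I).im = t := by simp
  rw [e2, div_eq_mul_inv] at e1
  have e3 : |σ - a| ≤ ‖(((σ - a : ℝ):ℂ) + t * Complex.I)‖ := by
    simpa using Complex.abs_re_le_norm (((σ - a : ℝ):ℂ) + t * Complex.I)
  have e4 : 0 < |σ - a| := abs_pos.mpr hsa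
  gcongr
  exact (norm_nonneg _).trans e1

lemma contour_s2 (U : ℂ → ℂ) (σ₁ σ₂ a K : ℝ) (h1 : σ₁ < a) (h2 : a < σ₂)
    (hU : DifferentiableOn ℂ U {s | σ₁ ≤ s.re ∧ s.re ≤ σ₂})
    (hK : ∀ s : ℂ, σ₁ ≤ s.re → s.re ≤ σ₂ → ‖U s‖ ≤ K / (1 + s.im ^ 2)) :
    (∫ t : ℝ, U (σ₂ + t * Complex.I) * (((σ₂ - a : ℝ):ℂ) + t * Complex.I)⁻¹) -
    (∫ t : ℝ, U (σ₁ + t * Complex.I) * (((σ₁ - a : ℝ):ℂ) + t * Complex.I)⁻¹) =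
    2 * π * U a := by
  set S : Set ℂ := {s | σ₁ ≤ s.re ∧ s.re ≤ σ₂} with hS
  have hSn : S ∈ 𝓝 (a:ℂ) := by
    have ho : IsOpen {s : ℂ | σ₁ < s.re ∧ s.re < σ₂} :=
      (isOpen_lt continuous_const Complex.continuous_re).inter
        (isOpen_lt Complex.continuous_re continuous_const)
    refine mem_of_superset (ho.mem_nhds (by simp [h1, h2])) ?_
    rintro s ⟨hs1, hs2⟩
    exact ⟨hs1.le, hs2.le⟩
  set q := dslope U (a:ℂ) with hq
  have hqd : DifferentiableOn ℂ q S := (Complex.differentiableOn_dslope hSn).mpr hU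
  have hqe : ∀ s : ℂ, s ≠ a → q s = (U s - U a) * (s - a)⁻¹ := by
    intro s hs
    rw [hq, dslope_of_ne _ hs, slope_def_field, div_eq_mul_inv]
  have hline : ∀ σ : ℝ, σ₁ ≤ σ → σ ≤ σ₂ → σ ≠ a → ∀ T : ℝ,
      ∫ t in (-T)..T, q (σ + t * Complex.I) =
      (∫ t in (-T)..T, U (σ + t * Complex.I) * (((σ - a : ℝ):ℂ) + t * Complex.I)⁻¹)
       - U a * ∫ t in (-T)..T, (((σ - a : ℝ):ℂ) + t * Complex.I)⁻¹ := by
    intro σ e1 e2 e3 T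
    rw [← intervalIntegral.integral_const_mul, ← intervalIntegral.integral_sub]
    · congr 1
      ext t
      rw [hqe]
      · push_cast; ring
      · intro h
        apply e3
        simpa using congrArg Complex.re h
    · exact (line_integrable U σ₁ σ₂ σ a K e1 e2 e3 hU hK).intervalIntegrable
    · exact ((inv_cont _ (sub_ne_zero.mpr e3)).const_mul _).intervalIntegrable _ _
  have hlim : ∀ σ : ℝ, σ₁ ≤ σ → σ ≤ σ₂ → σ ≠ a →
      Tendsto (fun T : ℝ => ∫ t in (-T)..T, U (σ + t * Complex.I) * (((σ - a : ℝ):ℂ) + t * Complex.I)⁻¹)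
        atTop (𝓝 (∫ t : ℝ, U (σ + t * Complex.I) * (((σ - a : ℝ):ℂ) + t * Complex.I)⁻¹)) := by
    intro σ e1 e2 e3
    exact intervalIntegral_tendsto_integral (line_integrable U σ₁ σ₂ σ a K e1 e2 e3 hU hK)
      tendsto_neg_atTop_atBot tendsto_id
  have hR := ((hlim σ₂ (by linarith) le_rfl h2.ne').sub
    ((inv_line (σ₂ - a) (by linarith)).const_mul (U a)))
  have hL := ((hlim σ₁ le_rfl (by linarith) h1.ne).sub
    ((inv_line_neg (σ₁ - a) (by linarith)).const_mul (U a)))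
  have hK0 : 0 ≤ K := by
    have := (norm_nonneg _).trans (hK a (by simpa using h1.le) (by simpa using h2.le))
    simpa using this
  have hhor : ∀ T : ℝ, T ≠ 0 → ‖∫ x in σ₁..σ₂, q (x + T * Complex.I)‖
      ≤ (K + ‖U a‖) * |T|⁻¹ * |σ₂ - σ₁| := by
    intro T hT
    apply intervalIntegral.norm_integral_le_of_norm_le_const
    intro x hx
    rw [Set.uIoc_of_le (by linarith)] at hx
    have hne : (x:ℂ) + T * Complex.I ≠ a := by
      intro h
      apply hT
      simpa using congrArg Complex.im h
    rw [hqe _ hne, norm_mul, norm_inv]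
    have e1 : ‖U (x + T * Complex.I)‖ ≤ K := by
      refine (hK _ (by simpa using hx.1.le) (by simpa using hx.2)).trans ?_
      apply div_le_self hK0
      nlinarith [sq_nonneg ((x:ℂ) + T * Complex.I).im]
    have e2 : |T| ≤ ‖(x:ℂ) + T * Complex.I - a‖ := by
      simpa using Complex.abs_im_le_norm ((x:ℂ) + T * Complex.I - a)
    have e3 : 0 < |T| := abs_pos.mpr hT
    have e4 : ‖U (x + T * Complex.I) - U a‖ ≤ K + ‖U a‖ := (norm_sub_le _ _).trans (by linarith)
    gcongr
  have hz : Tendsto (fun T : ℝ => (K + ‖U a‖) * |T|⁻¹ * |σ₂ - σ₁|) atTop (𝓝 0) := by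
    have : Tendsto (fun T : ℝ => |T|⁻¹) atTop (𝓝 0) :=
      tendsto_inv_atTop_zero.comp tendsto_abs_atTop_atTop
    simpa using (this.const_mul (K + ‖U a‖)).mul_const |σ₂ - σ₁|
  have hE1 : Tendsto (fun T : ℝ => ∫ x in σ₁..σ₂, q (x + (T:ℝ) * Complex.I)) atTop (𝓝 0) := by
    apply squeeze_zero_norm' _ hz
    filter_upwards [eventually_gt_atTop 0] with T hT using hhor T hT.ne'
  have hE2 : Tendsto (fun T : ℝ => ∫ x in σ₁..σ₂, q (x + (-T:ℝ) * Complex.I)) atTop (𝓝 0) := by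
    apply squeeze_zero_norm' _ hz
    filter_upwards [eventually_gt_atTop 0] with T hT
    simpa using hhor (-T) (by linarith)
  have hrect : ∀ T : ℝ, 
      (∫ x in σ₁..σ₂, q (x + (-T:ℝ) * Complex.I)) - (∫ x in σ₁..σ₂, q (x + (T:ℝ) * Complex.I)) +
      Complex.I * ((∫ t in (-T)..T, q (σ₂ + t * Complex.I)) -
       (∫ t in (-T)..T, q (σ₁ + t * Complex.I))) = 0 := by
    intro T
    have := Complex.integral_boundary_rect_eq_zero_of_differentiableOn q
      (⟨σ₁, -T⟩ : ℂ) (⟨σ₂, T⟩ : ℂ) (hqd.mono (by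
        rintro s ⟨hs, -⟩
        have hs' : s.re ∈ Set.uIcc σ₁ σ₂ := hs
        rw [Set.uIcc_of_le (by linarith)] at hs'
        exact hs'))
    simp only [smul_eq_mul] at this
    rw [← this]; ring
  have hfin := (hE2.sub hE1).add ((hR.sub hL).const_mul Complex.I)
  have hzero : Tendsto (fun _ : ℝ => (0:ℂ)) atTop (𝓝 0) := tendsto_const_nhds
  have := tendsto_nhds_unique hzero (hfin.congr (fun T => by
    rw [← hline σ₂ (by linarith) le_rfl h2.ne', ← hline σ₁ le_rfl (by linarith) h1.ne]
    exact hrect T))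
  rw [sub_zero, zero_add, eq_comm, mul_eq_zero] at this
  have := this.resolve_left Complex.I_ne_zero
  linear_combination this


lemma gamma_vert (c : ℝ) (hc : 0 < c) :
    Integrable fun t : ℝ => Complex.Gamma (c + t * Complex.I) := by
  obtain ⟨K, hK0, hK⟩ := gamma_bound_s2 2 c c hc
  have hcont : Continuous fun t : ℝ => Complex.Gamma (c + t * Complex.I) := by
    rw [continuous_iff_continuousAt]
    intro t
    have h : DifferentiableAt ℂ Complex.Gamma (c + t * Complex.I) :=
      Complex.differentiableAt_Gamma _ (fun m => by
        intro h
        have := congrArg Complex.re h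
        simp at this
        have h2 : (0:ℝ) ≤ m := m.cast_nonneg
        linarith)
    exact ContinuousAt.comp (f := fun t : ℝ => (c:ℂ) + t * Complex.I) h.continuousAt (by fun_prop)
  refine (integrable_inv_one_add_sq.const_mul K).mono' hcont.aestronglyMeasurable ?_
  filter_upwards with t
  have := hK (c + t * Complex.I) (by simp) (by simp)
  have e : ((c:ℂ) + t * Complex.I).im = t := by simp
  rw [e] at this
  rw [← div_eq_mul_inv, le_div_iff₀ (by positivity)]
  refine le_trans ?_ this
  gcongr
  nlinarith [abs_nonneg t, sq_abs t]

lemma exp_inv_mellin (c x : ℝ) (hc : 0 < c) (hx : 0 < x) :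
    ((Real.exp (-x) : ℝ) : ℂ) = (1 / (2 * π) : ℝ) *
      ∫ t : ℝ, (x:ℂ) ^ (-((c:ℂ) + t * Complex.I)) * Complex.Gamma (c + t * Complex.I) := by
  have hm : ∀ s : ℂ, 0 < s.re → mellin (fun x : ℝ => ((Real.exp (-x) : ℝ) : ℂ)) s = Complex.Gamma s := by
    intro s hs
    rw [Complex.Gamma_eq_integral hs, Complex.GammaIntegral_eq_mellin]
  have hm' : ∀ t : ℝ, mellin (fun x : ℝ => ((Real.exp (-x) : ℝ) : ℂ)) (c + t * Complex.I)
      = Complex.Gamma (c + t * Complex.I) := fun t => hm _ (by simpa using hc)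
  have h := mellinInv_mellin_eq c (fun x : ℝ => ((Real.exp (-x) : ℝ) : ℂ)) hx ?_ ?_ ?_
  · rw [← h, mellinInv]
    simp_rw [hm', smul_eq_mul]
    rw [Complex.real_smul]
  · have := Complex.GammaIntegral_convergent (s := c) (by simpa using hc)
    refine this.congr_fun (fun t _ => ?_) measurableSet_Ioi
    simp [mul_comm]
  · refine (gamma_vert c hc).congr ?_
    filter_upwards with t
    exact (hm' t).symm
  · fun_prop

lemma mellin_series {ι : Type} [Countable ι] (a p : ι → ℝ) (c x : ℝ) (hc : 0 < c) (hx : 0 < x)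
    (ha : ∀ i, 0 ≤ a i) (hp : ∀ i, 0 < p i) (hs : Summable fun i => a i * p i ^ (-c)) :
    HasSum (fun i => ((a i * Real.exp (-(p i * x)) : ℝ) : ℂ)) ((1 / (2 * π) : ℝ) *
      ∫ t : ℝ, (x:ℂ) ^ (-((c:ℂ) + t * Complex.I)) * Complex.Gamma (c + t * Complex.I) *
        ∑' i, (a i : ℂ) * (p i : ℂ) ^ (-((c:ℂ) + t * Complex.I))) := by
  have hItgZero : ∀ y : ℝ, 0 < y → Integrable fun t : ℝ =>
      (y:ℂ) ^ (-((c:ℂ) + t * Complex.I)) * Complex.Gamma (c + t * Complex.I) := by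
    intro y hy
    have hcy : Continuous fun t : ℝ => (y:ℂ) ^ (-((c:ℂ) + t * Complex.I)) := by
      have : (y:ℂ) ≠ 0 := by exact_mod_cast hy.ne'
      refine Continuous.const_cpow (by fun_prop) (Or.inl this)
    refine (gamma_vert c hc).bdd_mul (c := y ^ (-c)) hcy.aestronglyMeasurable ?_
    filter_upwards with t
    rw [Complex.norm_cpow_eq_rpow_re_of_pos hy]
    simp
  have hF : ∀ i (t : ℝ), ((p i * x : ℝ):ℂ) ^ (-((c:ℂ) + t * Complex.I))
      = (p i : ℂ) ^ (-((c:ℂ) + t * Complex.I)) * (x : ℂ) ^ (-((c:ℂ) + t * Complex.I)) := by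
    intro i t
    push_cast
    exact Complex.mul_cpow_ofReal_nonneg (hp i).le hx.le _
  have hItg : ∀ i, Integrable fun t : ℝ => (a i : ℂ) * (((p i * x : ℝ):ℂ) ^ (-((c:ℂ) + t * Complex.I))
      * Complex.Gamma (c + t * Complex.I)) := fun i =>
    (hItgZero _ (mul_pos (hp i) hx)).const_mul _
  have hsum : Summable fun i => ∫ t : ℝ, ‖(a i : ℂ) * (((p i * x : ℝ):ℂ) ^ (-((c:ℂ) + t * Complex.I))
      * Complex.Gamma (c + t * Complex.I))‖ := by
    have e : ∀ i (t : ℝ), ‖(a i : ℂ) * (((p i * x : ℝ):ℂ) ^ (-((c:ℂ) + t * Complex.I))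
      * Complex.Gamma (c + t * Complex.I))‖ = (a i * p i ^ (-c)) *
        (x ^ (-c) * ‖Complex.Gamma (c + t * Complex.I)‖) := by
      intro i t
      rw [norm_mul, norm_mul, Complex.norm_cpow_eq_rpow_re_of_pos (mul_pos (hp i) hx),
        Complex.norm_real, Real.norm_eq_abs, abs_of_nonneg (ha i),
        Real.mul_rpow (hp i).le hx.le]
      simp
      ring
    simp_rw [e, integral_const_mul]
    exact hs.mul_right _
  have h := (hasSum_integral_of_summable_integral_norm hItg hsum).mul_left (((1 / (2 * π) : ℝ)) : ℂ)
  have e1 : ∀ i, ((a i * Real.exp (-(p i * x)) : ℝ) : ℂ) = ((1 / (2 * π) : ℝ) : ℂ) *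
      ∫ t : ℝ, (a i : ℂ) * (((p i * x : ℝ):ℂ) ^ (-((c:ℂ) + t * Complex.I))
      * Complex.Gamma (c + t * Complex.I)) := by
    intro i
    rw [integral_const_mul, Complex.ofReal_mul, exp_inv_mellin c (p i * x) hc (mul_pos (hp i) hx)]
    ring
  have e2 : ∀ t : ℝ, (x:ℂ) ^ (-((c:ℂ) + t * Complex.I)) * Complex.Gamma (c + t * Complex.I) *
        ∑' i, (a i : ℂ) * (p i : ℂ) ^ (-((c:ℂ) + t * Complex.I)) =
        ∑' i, (a i : ℂ) * (((p i * x : ℝ):ℂ) ^ (-((c:ℂ) + t * Complex.I))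
      * Complex.Gamma (c + t * Complex.I)) := by
    intro t
    rw [← tsum_mul_left]
    refine tsum_congr fun i => ?_
    rw [hF]
    ring
  simp_rw [e2]
  rw [funext e1]
  exact h


lemma b_summable (b : ℕ → ℝ) (hb : ∀ k, 0 ≤ b k) (ρ : ℝ) (Dc : ℂ → ℂ)
    (hD : ∀ s : ℂ, ρ < s.re →
      HasSum (fun k : ℕ => (b (k + 1) : ℂ) * ((k + 1 : ℕ) : ℂ) ^ (-s)) (Dc s)) (σ : ℝ) (hσ : ρ < σ) :
    Summable fun k : ℕ => b (k + 1) * ((k + 1 : ℕ) : ℝ) ^ (-σ) := by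
  have h := (hD σ (by simpa using hσ)).summable.norm
  refine h.congr fun k => ?_
  have hk : (0:ℝ) < ((k + 1 : ℕ) : ℝ) := by positivity
  have e : (((k + 1 : ℕ) : ℝ) : ℂ) = ((k + 1 : ℕ) : ℂ) := by push_cast; rfl
  rw [norm_mul, Complex.norm_real, Real.norm_eq_abs, abs_of_nonneg (hb _), ← e,
    Complex.norm_cpow_eq_rpow_re_of_pos hk]
  simp

lemma zeta_summable (σ : ℝ) (hσ : 1 < σ) : Summable fun j : ℕ => ((j + 1 : ℕ) : ℝ) ^ (-σ) := by
  have h := (Real.summable_nat_rpow (p := -σ)).mpr (by linarith)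
  exact (summable_nat_add_iff 1).mpr h

lemma series_repr (b : ℕ → ℝ) (hb : ∀ k, 0 ≤ b k) (ρ : ℝ) (hρ : 0 < ρ) (Dc : ℂ → ℂ)
    (hD : ∀ s : ℂ, ρ < s.re →
      HasSum (fun k : ℕ => (b (k + 1) : ℂ) * ((k + 1 : ℕ) : ℂ) ^ (-s)) (Dc s)) (c x : ℝ)
    (hc : ρ + 1 < c) (hx : 0 < x) :
    HasSum (fun k : ℕ => ((b (k + 1) * ((k + 1 : ℕ) : ℝ) *
        (Real.exp (-x) ^ (k + 1) / (1 - Real.exp (-x) ^ (k + 1))) : ℝ) : ℂ)) ((1 / (2 * π) : ℝ) *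
      ∫ t : ℝ, (x:ℂ) ^ (-((c:ℂ) + t * Complex.I)) * Complex.Gamma (c + t * Complex.I) *
        (Dc (c + t * Complex.I - 1) * riemannZeta (c + t * Complex.I))) := by
  have hpos : ∀ k : ℕ, (0:ℝ) < ((k + 1 : ℕ) : ℝ) := fun k => by positivity
  have hsb := b_summable b hb ρ Dc hD (c - 1) (by linarith)
  have hsz := zeta_summable c (by linarith)
  have key := mellin_series (ι := ℕ × ℕ) (fun i => b (i.1 + 1) * ((i.1 + 1 : ℕ) : ℝ))
    (fun i => ((i.1 + 1 : ℕ) : ℝ) * ((i.2 + 1 : ℕ) : ℝ)) c x (by linarith) hx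
    (fun i => mul_nonneg (hb _) (hpos _).le) (fun i => mul_pos (hpos _) (hpos _)) (by
      have := hsb.mul_of_nonneg hsz (fun k => mul_nonneg (hb _) (Real.rpow_nonneg (hpos k).le _))
        (fun k => Real.rpow_nonneg (hpos k).le _)
      refine this.congr fun i => ?_
      rw [Real.mul_rpow (hpos _).le (hpos _).le]
      have : -(c - 1) = 1 + -c := by ring
      rw [this, Real.rpow_add (hpos _), Real.rpow_one]
      ring)
  have hItg : ∀ t : ℝ, ∑' i : ℕ × ℕ, ((b (i.1 + 1) * ((i.1 + 1 : ℕ) : ℝ) : ℝ) : ℂ) *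
      ((((i.1 + 1 : ℕ) : ℝ) * ((i.2 + 1 : ℕ) : ℝ) : ℝ) : ℂ) ^ (-((c:ℂ) + t * Complex.I))
      = Dc (c + t * Complex.I - 1) * riemannZeta (c + t * Complex.I) := by
    intro t
    set s : ℂ := c + t * Complex.I with hs
    have hsre : s.re = c := by simp [hs]
    have h1 := hD (s - 1) (by simp [hsre]; linarith)
    have h2 : HasSum (fun j : ℕ => ((j + 1 : ℕ) : ℂ) ^ (-s)) (riemannZeta s) := by
      rw [zeta_eq_tsum_one_div_nat_add_one_cpow (by rw [hsre]; linarith)]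
      have : Summable fun j : ℕ => ((j + 1 : ℕ) : ℂ) ^ (-s) := by
        apply Summable.of_norm
        refine hsz.congr fun j => ?_
        have e : (((j + 1 : ℕ) : ℝ) : ℂ) = ((j + 1 : ℕ) : ℂ) := by push_cast; rfl
        rw [← e, Complex.norm_cpow_eq_rpow_re_of_pos (hpos j)]
        simp [hsre]
      convert this.hasSum using 1
      refine tsum_congr fun j => ?_
      rw [Complex.cpow_neg]
      push_cast
      rw [one_div]
    rw [← h1.tsum_eq, ← h2.tsum_eq, tsum_mul_tsum_of_summable_norm h1.summable.norm h2.summable.norm]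
    refine tsum_congr fun i => ?_
    have e0 : ((((i.1 + 1 : ℕ) : ℝ) * ((i.2 + 1 : ℕ) : ℝ) : ℝ) : ℂ) ^ (-s)
        = ((i.1 + 1 : ℕ) : ℂ) ^ (-s) * ((i.2 + 1 : ℕ) : ℂ) ^ (-s) := by
      have := Complex.mul_cpow_ofReal_nonneg (hpos i.1).le (hpos i.2).le (-s)
      rw [Complex.ofReal_mul, this, Complex.ofReal_natCast, Complex.ofReal_natCast]
    have e1 : ((i.1 + 1 : ℕ) : ℂ) ^ (-(s - 1))
        = ((i.1 + 1 : ℕ) : ℂ) * ((i.1 + 1 : ℕ) : ℂ) ^ (-s) := by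
      have : -(s - 1) = 1 + -s := by ring
      rw [this, Complex.cpow_add _ _ (Nat.cast_ne_zero.mpr (Nat.succ_ne_zero _)), Complex.cpow_one]
    rw [e0, e1, Complex.ofReal_mul, Complex.ofReal_natCast]
    ring
  simp_rw [hItg] at key
  refine key.prod_fiberwise (fun k => ?_)
  have hr0 : 0 ≤ Real.exp (-x) ^ (k + 1) := by positivity
  have hr1 : Real.exp (-x) ^ (k + 1) < 1 :=
    pow_lt_one₀ (Real.exp_pos _).le (by rw [Real.exp_lt_one_iff]; linarith) (Nat.succ_ne_zero _)
  have hg := ((hasSum_geometric_of_lt_one hr0 hr1).mul_left (Real.exp (-x) ^ (k + 1))).mul_left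
    (b (k + 1) * ((k + 1 : ℕ) : ℝ))
  rw [← div_eq_mul_inv] at hg
  rw [Complex.hasSum_ofReal]
  have hexp : ∀ j : ℕ, Real.exp (-(((k + 1 : ℕ) : ℝ) * ((j + 1 : ℕ) : ℝ) * x))
      = Real.exp (-x) ^ (k + 1) * (Real.exp (-x) ^ (k + 1)) ^ j := by
    intro j
    rw [← pow_succ', ← pow_mul, ← Real.exp_nat_mul]
    congr 1
    push_cast
    ring
  simp_rw [hexp]
  exact hg

lemma Abf_eq (b : ℕ → ℝ) (hb : ∀ k, 0 ≤ b k) (ρ : ℝ) (hρ : 0 < ρ) (Dc : ℂ → ℂ)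
    (hD : ∀ s : ℂ, ρ < s.re →
      HasSum (fun k : ℕ => (b (k + 1) : ℂ) * ((k + 1 : ℕ) : ℂ) ^ (-s)) (Dc s)) (x : ℝ) (hx : 0 < x) :
    Abf b (Real.exp (-x)) = ∑' k : ℕ, (b (k + 1) * ((k + 1 : ℕ) : ℝ) *
        (Real.exp (-x) ^ (k + 1) / (1 - Real.exp (-x) ^ (k + 1)))) := by
  set R := Real.exp (-(x / 2)) with hR
  have hR0 : 0 < R := Real.exp_pos _
  have hR1 : R < 1 := by rw [hR, Real.exp_lt_one_iff]; linarith
  set r := Real.exp (-x) with hr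
  have hr0 : 0 < r := Real.exp_pos _
  have hrR : r < R := by rw [hr, hR, Real.exp_lt_exp]; linarith
  have hsR : Summable fun k : ℕ => (b (k + 1) * ((k + 1 : ℕ) : ℝ) *
        (R ^ (k + 1) / (1 - R ^ (k + 1)))) :=
    Complex.summable_ofReal.mp (series_repr b hb ρ hρ Dc hD (ρ + 2) (x / 2) (by linarith)
      (by linarith)).summable
  have hRk : ∀ k : ℕ, R ^ (k + 1) < 1 := fun k => pow_lt_one₀ hR0.le hR1 (Nat.succ_ne_zero _)
  have hyk : ∀ k : ℕ, ∀ y ∈ Set.Ioo (-R) R, y ^ (k + 1) ≤ R ^ (k + 1) := by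
    intro k y hy
    refine (le_abs_self _).trans ?_
    rw [abs_pow]
    exact pow_le_pow_left₀ (abs_nonneg _) (abs_lt.mpr hy).le _
  have hder : HasDerivAt (fun y : ℝ => ∑' k : ℕ, b (k + 1) * Real.log (1 - y ^ (k + 1)))
      (∑' k : ℕ, b (k + 1) * (-(((k + 1 : ℕ) : ℝ) * r ^ k) / (1 - r ^ (k + 1)))) r := by
    apply hasDerivAt_tsum_of_isPreconnected (t := Set.Ioo (-R) R) (y₀ := 0) (hsR.mul_right R⁻¹)
      isOpen_Ioo isPreconnected_Ioo
      (g := fun (k : ℕ) (y : ℝ) => b (k + 1) * Real.log (1 - y ^ (k + 1)))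
      (g' := fun (k : ℕ) (y : ℝ) => b (k + 1) * (-(((k + 1 : ℕ) : ℝ) * y ^ k) / (1 - y ^ (k + 1))))
    · intro k y hy
      have h1 := hyk k y hy
      have h2 := hRk k
      have := ((hasDerivAt_pow (k + 1) y).const_sub 1).log (by linarith)
      simpa using this.const_mul (b (k + 1))
    · intro k y hy
      have h1 := hyk k y hy
      have h2 := hRk k
      rw [norm_mul, norm_div, norm_neg, norm_mul, Real.norm_eq_abs, abs_of_nonneg (hb _), norm_pow,
        Real.norm_eq_abs (1 - _), abs_of_pos (by linarith : 0 < 1 - y ^ (k + 1)), Real.norm_natCast,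
        Real.norm_eq_abs]
      have h3 : |y| ≤ R := (abs_lt.mpr hy).le
      have h4 : b (k + 1) * ((k + 1 : ℕ) : ℝ) * (R ^ (k + 1) / (1 - R ^ (k + 1))) * R⁻¹
          = b (k + 1) * (((k + 1 : ℕ) : ℝ) * R ^ k / (1 - R ^ (k + 1))) := by
        have : 1 - R ^ (k + 1) ≠ 0 := by linarith
        rw [pow_succ] at this ⊢
        field_simp
      rw [h4]
      have h5 : 0 < 1 - R ^ (k + 1) := by linarith
      have := hb (k + 1)
      gcongr
    · exact ⟨by linarith, hR0⟩
    · simp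
    · exact ⟨by linarith, hrR⟩
  have hF : HasDerivAt (Fb b) (-∑' k : ℕ, b (k + 1) * (-(((k + 1 : ℕ) : ℝ) * r ^ k) / (1 - r ^ (k + 1)))) r :=
    hder.neg
  rw [Abf, hF.deriv, ← tsum_neg, ← tsum_mul_left]
  refine tsum_congr fun k => ?_
  rw [pow_succ]
  ring


lemma W_bound (ρ C₀ A C₁ : ℝ) (Dc φ : ℂ → ℂ) (h2 : M2 C₀ C₁ Dc)
    (hφ : ∀ s : ℂ, -C₀ ≤ s.re → DifferentiableAt ℂ φ s)
    (hDφ : ∀ s : ℂ, -C₀ ≤ s.re → s ≠ (ρ : ℂ) → Dc s = (A : ℂ) / (s - (ρ : ℂ)) + φ s)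
    (σ₂ : ℝ) : ∃ (K : ℝ) (N : ℕ), 0 ≤ K ∧ ∀ s : ℂ, 1 - C₀ ≤ s.re → s.re ≤ σ₂ →
      ‖(A : ℂ) + (s - 1 - ρ) * φ (s - 1)‖ ≤ K * (1 + |s.im|) ^ N := by
  obtain ⟨hC1, K, y₀, hK⟩ := h2
  set Y := max y₀ 1 with hY
  have hcomp : IsCompact (Set.Icc (1 - C₀) σ₂ ×ℂ Set.Icc (-Y) Y) :=
    isCompact_Icc.reProdIm isCompact_Icc
  have hcont : ContinuousOn (fun s : ℂ => (A : ℂ) + (s - 1 - ρ) * φ (s - 1))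
      (Set.Icc (1 - C₀) σ₂ ×ℂ Set.Icc (-Y) Y) := by
    intro s hs
    have h1 : 1 - C₀ ≤ s.re := hs.1.1
    have h3 : ContinuousAt φ (s - 1) := (hφ (s - 1) (by simp; linarith)).continuousAt
    have h4 : ContinuousAt (fun s : ℂ => φ (s - 1)) s :=
      ContinuousAt.comp (f := fun s : ℂ => s - 1) h3 (by fun_prop)
    apply ContinuousAt.continuousWithinAt
    fun_prop
  obtain ⟨B, hB⟩ := hcomp.exists_bound_of_continuousOn hcont
  set M := |1 - C₀| + |σ₂| + 1 + |ρ| + 1 with hM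
  have hM0 : 0 ≤ M := by positivity
  refine ⟨max (|B|) (M * |K|), ⌈C₁⌉₊ + 1, by positivity, fun s hs1 hs2 => ?_⟩
  have hone : (1:ℝ) ≤ 1 + |s.im| := by linarith [abs_nonneg s.im]
  by_cases hcase : |s.im| ≤ Y
  · have h1 := hB s ⟨⟨hs1, hs2⟩, abs_le.mp hcase⟩
    calc _ ≤ B := h1
      _ ≤ max (|B|) (M * |K|) := (le_abs_self B).trans (le_max_left _ _)
      _ ≤ _ := le_mul_of_one_le_right (by positivity) (one_le_pow₀ hone)
  · push Not at hcase
    have hy0 : y₀ ≤ |s.im| := (le_max_left _ _).trans hcase.le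
    have hy1 : 1 ≤ |s.im| := (le_max_right _ _).trans hcase.le
    have hne : s - 1 ≠ (ρ:ℂ) := by
      intro h
      have := congrArg Complex.im h
      simp at this
      rw [this] at hy1
      simp at hy1
      linarith
    have hne' : s - 1 - ρ ≠ 0 := sub_ne_zero.mpr hne
    have hre : -C₀ ≤ (s - 1).re := by simp; linarith
    have e : (A : ℂ) + (s - 1 - ρ) * φ (s - 1) = (s - 1 - ρ) * Dc (s - 1) := by
      rw [hDφ _ hre hne]
      field_simp
    have h3 := hK (s - 1) hre (by simpa using hy0)
    have e2 : (s - 1).im = s.im := by simp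
    rw [e2] at h3
    have h4 : |s.im| ^ C₁ ≤ (1 + |s.im|) ^ ⌈C₁⌉₊ := by
      calc |s.im| ^ C₁ ≤ (1 + |s.im|) ^ C₁ := by gcongr; linarith
        _ ≤ (1 + |s.im|) ^ (⌈C₁⌉₊ : ℝ) := Real.rpow_le_rpow_of_exponent_le hone (Nat.le_ceil _)
        _ = _ := Real.rpow_natCast _ _
    have h5 : ‖s - 1 - ρ‖ ≤ M * (1 + |s.im|) := by
      have a1 : ‖s - 1 - ρ‖ ≤ ‖s‖ + 1 + |ρ| := by
        refine (norm_sub_le _ _).trans ?_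
        have := norm_sub_le s 1
        rw [norm_one] at this
        rw [Complex.norm_real, Real.norm_eq_abs]
        linarith
      have a2 := Complex.norm_le_abs_re_add_abs_im s
      have a3 : |s.re| ≤ |1 - C₀| + |σ₂| := by
        rw [abs_le]
        have := neg_abs_le (1 - C₀)
        have := le_abs_self σ₂
        constructor <;> linarith [abs_nonneg (1 - C₀), abs_nonneg σ₂]
      nlinarith [abs_nonneg s.im, abs_nonneg (1 - C₀), abs_nonneg σ₂, abs_nonneg ρ]
    rw [e, norm_mul]
    calc ‖s - 1 - ρ‖ * ‖Dc (s - 1)‖ ≤ (M * (1 + |s.im|)) * (|K| * (1 + |s.im|) ^ ⌈C₁⌉₊) := by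
          gcongr
          refine h3.trans ?_
          gcongr
          exact le_abs_self K
      _ = (M * |K|) * (1 + |s.im|) ^ (⌈C₁⌉₊ + 1) := by ring
      _ ≤ _ := by gcongr; exact le_max_right _ _

lemma U0_bound (ρ C₀ A C₁ : ℝ) (hC : C₀ < 1) (Dc φ : ℂ → ℂ) (h2 : M2 C₀ C₁ Dc)
    (hφ : ∀ s : ℂ, -C₀ ≤ s.re → DifferentiableAt ℂ φ s)
    (hDφ : ∀ s : ℂ, -C₀ ≤ s.re → s ≠ (ρ : ℂ) → Dc s = (A : ℂ) / (s - (ρ : ℂ)) + φ s)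
    (σ₂ : ℝ) : ∃ K : ℝ, 0 ≤ K ∧ ∀ s : ℂ, 1 - C₀ ≤ s.re → s.re ≤ σ₂ →
      ‖Complex.Gamma s * riemannZeta₁ s * ((A : ℂ) + (s - 1 - ρ) * φ (s - 1))‖
        ≤ K / (1 + s.im ^ 2) := by
  obtain ⟨K₁, N, hK₁, hW⟩ := W_bound ρ C₀ A C₁ Dc φ h2 hφ hDφ σ₂
  obtain ⟨K₂, hK₂, hZ⟩ := zeta_bound (1 - C₀) σ₂ (by linarith)
  obtain ⟨K₃, hK₃, hG⟩ := gamma_bound_s2 (N + 4) (1 - C₀) σ₂ (by linarith)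
  refine ⟨K₃ * K₂ * K₁, by positivity, fun s h1 h3 => ?_⟩
  rw [le_div_iff₀ (by positivity), norm_mul, norm_mul]
  have a1 := hW s h1 h3
  have a2 := hZ s h1 h3
  have a3 := hG s h1 h3
  have a4 : 1 + s.im ^ 2 ≤ (1 + |s.im|) ^ 2 := by nlinarith [abs_nonneg s.im, sq_abs s.im]
  calc ‖Complex.Gamma s‖ * ‖riemannZeta₁ s‖ * ‖(A : ℂ) + (s - 1 - ρ) * φ (s - 1)‖ * (1 + s.im ^ 2)
      ≤ ‖Complex.Gamma s‖ * (K₂ * (1 + |s.im|) ^ 2) * (K₁ * (1 + |s.im|) ^ N) * (1 + |s.im|) ^ 2 := by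
        gcongr
    _ = (‖Complex.Gamma s‖ * (1 + |s.im|) ^ (N + 4)) * K₂ * K₁ := by ring
    _ ≤ _ := by gcongr

lemma line_bound (U : ℂ → ℂ) (σ a K : ℝ) (ha : σ ≠ a)
    (hK : ∀ t : ℝ, ‖U (σ + t * Complex.I)‖ ≤ K / (1 + t ^ 2)) :
    ‖∫ t : ℝ, U (σ + t * Complex.I) * (((σ - a : ℝ):ℂ) + t * Complex.I)⁻¹‖ ≤ K * (π * |σ - a|⁻¹) := by
  have hsa : σ - a ≠ 0 := sub_ne_zero.mpr ha
  have e : ∫ t : ℝ, K * (1 + t ^ 2)⁻¹ * |σ - a|⁻¹ = K * (π * |σ - a|⁻¹) := by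
    rw [integral_mul_const, integral_const_mul, integral_univ_inv_one_add_sq]
    ring
  rw [← e]
  apply norm_integral_le_of_norm_le
  · exact (integrable_inv_one_add_sq.const_mul K).mul_const _
  filter_upwards with t
  rw [norm_mul, norm_inv]
  have e1 := hK t
  rw [div_eq_mul_inv] at e1
  have e3 : |σ - a| ≤ ‖(((σ - a : ℝ):ℂ) + t * Complex.I)‖ := by
    simpa using Complex.abs_re_le_norm (((σ - a : ℝ):ℂ) + t * Complex.I)
  have e4 : 0 < |σ - a| := abs_pos.mpr hsa
  gcongr
  exact (norm_nonneg _).trans e1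

theorem statement2    (b : ℕ → ℝ) (hb : ∀ k, 0 ≤ b k) (ρ C₀ A C₁ : ℝ) (Dc : ℂ → ℂ)
    (h1 : M1 b ρ C₀ A Dc) (h2 : M2 C₀ C₁ Dc) :
    (fun α : ℝ => Abf b (Real.exp (-α)) -
        (hMein ρ A * α ^ (-ρ - 1) + (Dc 0).re * α⁻¹ + (deriv Dc 0).re))
      =O[𝓝[>] (0 : ℝ)] fun α : ℝ => α ^ (C₀ - 1) := by
  obtain ⟨hρ, hC0, hC1, hA, hD, hdiff, φ, hφ, hDφ⟩ := h1
  set σ₁ : ℝ := 1 - C₀ with hσ₁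
  set σ₂ : ℝ := ρ + 2 with hσ₂
  obtain ⟨K, hK0, hK⟩ := U0_bound ρ C₀ A C₁ hC1 Dc φ h2 hφ hDφ σ₂
  set U0 : ℂ → ℂ := fun s =>
    Complex.Gamma s * riemannZeta₁ s * ((A : ℂ) + (s - 1 - ρ) * φ (s - 1)) with hU0
  have hU0d : ∀ s : ℂ, σ₁ ≤ s.re → DifferentiableAt ℂ U0 s := by
    intro s hs
    have g1 : DifferentiableAt ℂ Complex.Gamma s :=
      Complex.differentiableAt_Gamma _ (fun m => by
        intro h
        have h3 := congrArg Complex.re h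
        simp at h3
        have h4 : (0:ℝ) ≤ m := m.cast_nonneg
        linarith)
    have g2 : DifferentiableAt ℂ (fun s : ℂ => φ (s - 1)) s :=
      DifferentiableAt.comp (f := fun s : ℂ => s - 1) s (hφ (s - 1) (by simp; linarith))
        (by fun_prop)
    have g3 : DifferentiableAt ℂ riemannZeta₁ s := differentiable_riemannZeta₁ s
    have g4 : DifferentiableAt ℂ (fun s : ℂ => s - 1 - (ρ:ℂ)) s := by fun_prop
    exact (g1.mul g3).mul ((g4.mul g2).const_add (A:ℂ))
  -- the explicit identity
  have main : ∀ α : ℝ, 0 < α → α < 1 →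
      |Abf b (Real.exp (-α)) - (hMein ρ A * α ^ (-ρ - 1) + (Dc 0).re * α⁻¹)|
      ≤ (1 / (2 * π)) * (1 / ρ) * (K * (π * |σ₁ - (1 + ρ)|⁻¹) + K * (π * |σ₁ - 1|⁻¹))
        * α ^ (C₀ - 1) := by
    intro α hα hα1
    have hαc : (α:ℂ) ≠ 0 := by exact_mod_cast hα.ne'
    set U : ℂ → ℂ := fun s => (α:ℂ) ^ (-s) * U0 s with hU
    have hUd : DifferentiableOn ℂ U {s | σ₁ ≤ s.re ∧ s.re ≤ σ₂} := by
      intro s hs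
      have g1 := hU0d s hs.1
      have g2 : DifferentiableAt ℂ (fun s : ℂ => (α:ℂ) ^ (-s)) s :=
        DifferentiableAt.const_cpow (by fun_prop) (Or.inl hαc)
      exact (g2.mul g1).differentiableWithinAt
    have hnorm : ∀ s : ℂ, ‖(α:ℂ) ^ (-s)‖ = α ^ (-s.re) := by
      intro s
      rw [Complex.norm_cpow_eq_rpow_re_of_pos hα]
      simp
    have hUb : ∀ s : ℂ, σ₁ ≤ s.re → s.re ≤ σ₂ → ‖U s‖ ≤ (α ^ (-σ₂) * K) / (1 + s.im ^ 2) := by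
      intro s e1 e2
      rw [hU, norm_mul, hnorm, mul_div_assoc]
      gcongr ?_ * ?_
      · exact Real.rpow_le_rpow_of_exponent_ge hα hα1.le (by linarith)
      · exact hK s e1 e2
    have hUb1 : ∀ t : ℝ, ‖U (σ₁ + t * Complex.I)‖ ≤ (α ^ (-σ₁) * K) / (1 + t ^ 2) := by
      intro t
      rw [hU, norm_mul, hnorm, mul_div_assoc]
      have e3 := hK (σ₁ + t * Complex.I) (by simp; try linarith) (by simp; linarith)
      simp only [Complex.add_re, Complex.add_im, Complex.ofReal_re, Complex.ofReal_im,
        Complex.re_ofReal_mul, Complex.im_ofReal_mul, Complex.I_re, Complex.I_im, mul_zero,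
        mul_one, add_zero, zero_add] at e3 ⊢
      gcongr
    have c1 := contour_s2 U σ₁ σ₂ (1 + ρ) _ (by linarith) (by linarith) hUd hUb
    have c2 := contour_s2 U σ₁ σ₂ 1 _ (by linarith) (by linarith) hUd hUb
    have i1 := line_integrable U σ₁ σ₂ σ₂ (1 + ρ) _ (by linarith) le_rfl (by linarith) hUd hUb
    have i2 := line_integrable U σ₁ σ₂ σ₂ 1 _ (by linarith) le_rfl (by linarith) hUd hUb
    have b1 := line_bound U σ₁ (1 + ρ) _ (by linarith) hUb1
    have b2 := line_bound U σ₁ 1 _ (by linarith) hUb1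
    have hs := series_repr b hb ρ hρ Dc hD σ₂ α (by linarith) hα
    have hρc : (ρ:ℂ) ≠ 0 := by exact_mod_cast hρ.ne'
    have hItgEq : ∀ t : ℝ, (α:ℂ) ^ (-((σ₂:ℂ) + t * Complex.I)) * Complex.Gamma (σ₂ + t * Complex.I) *
        (Dc (σ₂ + t * Complex.I - 1) * riemannZeta (σ₂ + t * Complex.I))
        = (1 / (ρ:ℂ)) * (U (σ₂ + t * Complex.I) * (((σ₂ - (1 + ρ) : ℝ):ℂ) + t * Complex.I)⁻¹
          - U (σ₂ + t * Complex.I) * (((σ₂ - 1 : ℝ):ℂ) + t * Complex.I)⁻¹) := by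
      intro t
      have n1 := line_ne (σ₂ - (1 + ρ)) t (by linarith)
      have n2 := line_ne (σ₂ - 1) t (by linarith)
      set s : ℂ := σ₂ + t * Complex.I with hsdef
      have hsre : s.re = σ₂ := by simp [hsdef]
      have q1 : ((σ₂ - (1 + ρ) : ℝ):ℂ) + t * Complex.I = s - 1 - ρ := by
        rw [hsdef]; push_cast; ring
      have q2 : ((σ₂ - 1 : ℝ):ℂ) + t * Complex.I = s - 1 := by
        rw [hsdef]; push_cast; ring
      rw [q1] at n1 ⊢
      rw [q2] at n2 ⊢
      rw [hDφ (s - 1) (by simp [hsre]; linarith) (sub_ne_zero.mp n1),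
        riemannZeta_eq_inv_sub_mul (sub_ne_zero.mp n2)]
      simp only [hU, hU0]
      field_simp
      ring
    simp_rw [hItgEq] at hs
    rw [integral_const_mul, integral_sub i1 i2] at hs
    have hAbf := congrArg (fun x : ℝ => (x : ℂ)) (Abf_eq b hb ρ hρ Dc hD α hα)
    beta_reduce at hAbf
    rw [Complex.ofReal_tsum, hs.tsum_eq] at hAbf
    have hζ : riemannZeta₁ (1 + ρ) = ρ * riemannZeta (ρ + 1) := by
      have : (ρ:ℂ) + 1 ≠ 1 := by simpa using hρc
      rw [riemannZeta_eq_inv_sub_mul this, add_comm (1:ℂ)]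
      field_simp
      ring
    have v1 : U ((1 + ρ : ℝ):ℂ) = ρ * (((A * Real.Gamma (ρ + 1) * α ^ (-ρ - 1) : ℝ) : ℂ)
        * riemannZeta (ρ + 1)) := by
      have e1 : (α:ℂ) ^ (-((1 + ρ : ℝ):ℂ)) = ((α ^ (-ρ - 1) : ℝ) : ℂ) := by
        rw [Complex.ofReal_cpow hα.le]
        congr 1
        push_cast; ring
      simp only [hU, hU0]
      rw [e1, Complex.Gamma_ofReal, add_comm ρ 1]
      push_cast
      rw [hζ]
      ring
    have v2 : U ((1:ℝ):ℂ) = -ρ * (Dc 0 * ((α⁻¹ : ℝ):ℂ)) := by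
      simp only [hU, hU0]
      rw [hDφ 0 (by simpa using hC0.le) (by simpa using hρc.symm)]
      push_cast
      rw [Complex.cpow_neg_one, Complex.Gamma_one, riemannZeta₁_one, sub_self]
      field_simp
      ring
    rw [v1] at c1
    rw [v2] at c2
    set V1 := ∫ t : ℝ, U (σ₁ + t * Complex.I) * (((σ₁ - (1 + ρ) : ℝ):ℂ) + t * Complex.I)⁻¹ with hV1
    set V2 := ∫ t : ℝ, U (σ₁ + t * Complex.I) * (((σ₁ - 1 : ℝ):ℂ) + t * Complex.I)⁻¹ with hV2
    rw [sub_eq_iff_eq_add.mp c1, sub_eq_iff_eq_add.mp c2] at hAbf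
    have hπ : (π:ℂ) ≠ 0 := by exact_mod_cast Real.pi_ne_zero
    have hid : ((Abf b (Real.exp (-α)) : ℝ) : ℂ) - (((A * Real.Gamma (ρ + 1) * α ^ (-ρ - 1) : ℝ) : ℂ)
        * riemannZeta (ρ + 1) + Dc 0 * ((α⁻¹ : ℝ):ℂ)) = ((1 / (2 * π) * (1 / ρ) : ℝ) : ℂ) * (V1 - V2) := by
      rw [hAbf]
      push_cast
      field_simp
      ring
    have hre := congrArg Complex.re hid
    rw [Complex.sub_re, Complex.add_re, Complex.re_ofReal_mul, Complex.re_mul_ofReal,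
      Complex.ofReal_re, Complex.re_ofReal_mul] at hre
    have hh : hMein ρ A * α ^ (-ρ - 1) = A * Real.Gamma (ρ + 1) * α ^ (-ρ - 1) *
        (riemannZeta (ρ + 1)).re := by
      rw [hMein]; ring
    rw [hh, hre, abs_mul, abs_of_pos (by positivity : 0 < 1 / (2 * π) * (1 / ρ)),
      mul_assoc (1 / (2 * π) * (1 / ρ))]
    refine mul_le_mul_of_nonneg_left ?_ (by positivity)
    refine (Complex.abs_re_le_norm _).trans ((norm_sub_le _ _).trans ((add_le_add b1 b2).trans ?_))
    apply le_of_eq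
    have : -σ₁ = C₀ - 1 := by rw [hσ₁]; ring
    rw [this]
    ring
  apply IsBigO.of_bound ((1 / (2 * π)) * (1 / ρ) *
    (K * (π * |σ₁ - (1 + ρ)|⁻¹) + K * (π * |σ₁ - 1|⁻¹)) + |(deriv Dc 0).re|)
  filter_upwards [Ioo_mem_nhdsGT (zero_lt_one (α := ℝ))] with α hα
  have h3 := main α hα.1 hα.2
  have h4 : 1 ≤ α ^ (C₀ - 1) :=
    Real.one_le_rpow_of_pos_of_le_one_of_nonpos hα.1 hα.2.le (by linarith)
  rw [Real.norm_eq_abs, Real.norm_eq_abs, abs_of_pos (by linarith : 0 < α ^ (C₀ - 1)), add_mul]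
  have h5 : |(deriv Dc 0).re| ≤ |(deriv Dc 0).re| * α ^ (C₀ - 1) :=
    le_mul_of_one_le_right (abs_nonneg _) h4
  calc _ = |Abf b (Real.exp (-α)) - (hMein ρ A * α ^ (-ρ - 1) + (Dc 0).re * α⁻¹)
        - (deriv Dc 0).re| := by congr 1; ring
    _ ≤ _ := (abs_sub _ _).trans (add_le_add h3 h5)
end
end
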